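/- (Khovanskii–Pukhlikov formula for multi-polytopes) Let P be a simple lattice multi-polytope over a complete simplicial multi-fan Δ, and for h = (h_1,...,h_d)∈ℝ^d let P_h denote the multi-polytope with constants c_i + h_i. Then vol(P_h) is a polynomial in h_1,...,h_d, and applying the Todd differential operator T(∂/∂h) = Σ_{g∈G_Δ} ∏_{i=1}^d (∂/∂h_i)/(1 − ρ_i(g)e^{−∂/∂h_i}) and evaluating at h = 0 yields T(∂/∂h) vol(P_h)|_{h=0} = ♯(P). -/

import Mathlib

open Finset

/-- The pairing between a covector and a vector in `ℝⁿ`. -/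
def dotp {n : ℕ} (x y : Fin n → ℝ) : ℝ := ∑ k, x k * y k

/-- A (simplicial) multi-fan of dimension `n` with rays indexed by `{1,…,d}`:
an augmented simplicial set `S`, ray vectors `v i` spanning the simplicial cones
`C(I) = pos span {v i : i ∈ I}`, and a weight `w` on simplices (the difference
`w = w⁺ − w⁻` of the two weight functions, restricted to top simplices is what matters). -/
structure MultiFan (n d : ℕ) where
  S : Finset (Finset (Fin d))
  empty_mem : ∅ ∈ S
  downClosed : ∀ I ∈ S, ∀ J ⊆ I, J ∈ S
  card_le : ∀ I ∈ S, I.card ≤ n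
  v : Fin d → (Fin n → ℝ)
  indep : ∀ I ∈ S, LinearIndependent ℝ (fun i : {x // x ∈ I} => v i.1)
  w : Finset (Fin d) → ℤ

namespace MultiFan

variable {n d : ℕ}

/-- `x` is generic for the projected multi-fan `Δ_K`: it avoids every linear subspace
spanned by a cone (containing `C(K)`) of dimension `< n`. -/
def GenericFor (Δ : MultiFan n d) (K : Finset (Fin d)) (x : Fin n → ℝ) : Prop :=
  ∀ L ∈ Δ.S, K ⊆ L → L.card < n → x ∉ Submodule.span ℝ (Δ.v '' (L : Set (Fin d)))

def Generic (Δ : MultiFan n d) (x : Fin n → ℝ) : Prop := Δ.GenericFor ∅ x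

/-- `x` lies (mod the span of `C(K)`) in the projected cone `C_K(I)`. -/
def InProjCone (Δ : MultiFan n d) (K I : Finset (Fin d)) (x : Fin n → ℝ) : Prop :=
  ∃ a : Fin d → ℝ, (∀ j ∈ I \ K, 0 ≤ a j) ∧
    (x - ∑ j ∈ I \ K, a j • Δ.v j) ∈ Submodule.span ℝ (Δ.v '' (K : Set (Fin d)))

open scoped Classical in
/-- `d_x` for the projected multi-fan `Δ_K`: the sum of the weights of top cones whose
projection contains the projection of `x`. -/
noncomputable def dv (Δ : MultiFan n d) (K : Finset (Fin d)) (x : Fin n → ℝ) : ℤ :=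
  ∑ I ∈ Δ.S.filter (fun I => I.card = n ∧ K ⊆ I ∧ Δ.InProjCone K I x), Δ.w I

/-- Pre-completeness of the projected multi-fan `Δ_K`. -/
def PreCompleteAt (Δ : MultiFan n d) (K : Finset (Fin d)) : Prop :=
  (∃ I ∈ Δ.S, K ⊆ I ∧ I.card = n) ∧
  ∀ x y : Fin n → ℝ, Δ.GenericFor K x → Δ.GenericFor K y → Δ.dv K x = Δ.dv K y

/-- Completeness: every projected multi-fan is pre-complete. -/
def Complete (Δ : MultiFan n d) : Prop := ∀ K ∈ Δ.S, Δ.PreCompleteAt K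

open scoped Classical in
/-- The Duistermaat–Heckman function of the simple multi-polytope `(Δ, {F_i})`, where
`F_i = {u : ⟨u, v i⟩ = c i}`, the data `uu I i = u_i^I` is the dual basis of `{v i : i ∈ I}`
and `ξ ∈ V` is a generic vector.  For `I ∈ Σ^{(n)}` the coefficient of `u − u_I` on `u_i^I`
is `⟨u, v i⟩ − c i`, so membership in the cone `C^*(I)^+` is expressed by the conditions below. -/
noncomputable def DH (Δ : MultiFan n d) (c : Fin d → ℝ)
    (uu : Finset (Fin d) → Fin d → (Fin n → ℝ)) (ξ : Fin n → ℝ) (u : Fin n → ℝ) : ℤ :=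
  ∑ I ∈ Δ.S.filter (fun I => I.card = n),
    if (∀ i ∈ I, (0 < dotp (uu I i) ξ ∧ c i ≤ dotp u (Δ.v i)) ∨
                 (dotp (uu I i) ξ < 0 ∧ dotp u (Δ.v i) ≤ c i))
    then (-1 : ℤ) ^ (I.filter fun i => 0 < dotp (uu I i) ξ).card * Δ.w I
    else 0

/-- `uu I i = u_i^I` is the basis dual to `{v i : i ∈ I}` for each top simplex `I`. -/
def DualBasis (Δ : MultiFan n d) (uu : Finset (Fin d) → Fin d → (Fin n → ℝ)) : Prop :=
  ∀ I ∈ Δ.S, I.card = n → ∀ i ∈ I, ∀ j ∈ I,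
    dotp (uu I i) (Δ.v j) = if i = j then 1 else 0

/-- Genericity of `ξ` needed for the DH function: `⟨u_i^I, ξ⟩ ≠ 0` for all `I, i`. -/
def GenericDual (Δ : MultiFan n d) (uu : Finset (Fin d) → Fin d → (Fin n → ℝ))
    (ξ : Fin n → ℝ) : Prop :=
  ∀ I ∈ Δ.S, I.card = n → ∀ i ∈ I, dotp (uu I i) ξ ≠ 0

end MultiFan

/-- A (simplicial) multi-fan in the lattice `N = ℤⁿ`: the ray vectors `v i` are the
primitive integral generators of the one-dimensional cones. -/
structure LMultiFan (n d : ℕ) where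
  S : Finset (Finset (Fin d))
  empty_mem : ∅ ∈ S
  downClosed : ∀ I ∈ S, ∀ J ⊆ I, J ∈ S
  card_le : ∀ I ∈ S, I.card ≤ n
  v : Fin d → (Fin n → ℤ)
  indep : ∀ I ∈ S, LinearIndependent ℝ (fun i : {x // x ∈ I} => fun k => ((v i.1 k : ℝ)))
  w : Finset (Fin d) → ℤ

namespace LMultiFan

variable {n d : ℕ}

/-- The underlying real multi-fan. -/
def toMF (Δ : LMultiFan n d) : MultiFan n d where
  S := Δ.S
  empty_mem := Δ.empty_mem
  downClosed := Δ.downClosed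
  card_le := Δ.card_le
  v := fun i k => (Δ.v i k : ℝ)
  indep := Δ.indep
  w := Δ.w

/-- The vertices `u_I = ∑_{i∈I} c_i u_i^I` of the multi-polytope with constants `c` all lie
in the lattice `N^* = ℤⁿ`, i.e. the multi-polytope is a lattice multi-polytope. -/
def LatticeVertices (Δ : LMultiFan n d) (c : Fin d → ℝ)
    (uu : Finset (Fin d) → Fin d → (Fin n → ℝ)) : Prop :=
  ∀ I ∈ Δ.S, I.card = n → ∀ k : Fin n, ∃ m : ℤ, (∑ i ∈ I, c i * uu I i k) = (m : ℝ)

/-- `♯(P) = ∑_{u ∈ N^*} DH_{P_+}(u)`, where `P_+` is the small outward enlargement of the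
lattice multi-polytope `P` (each hyperplane `⟨·, v_i⟩ = c_i` is moved in the direction of
`v_i`; since all `c_i` are integers, moving by `1/2` realizes the small enlargement). -/
noncomputable def sharpP (Δ : LMultiFan n d) (c : Fin d → ℝ)
    (uu : Finset (Fin d) → Fin d → (Fin n → ℝ)) (ξ : Fin n → ℝ) : ℤ :=
  ∑ᶠ u : Fin n → ℤ, Δ.toMF.DH (fun i => c i + 1/2) uu ξ (fun k => (u k : ℝ))

/-- `♯(P°) = ∑_{u ∈ N^*} DH_{P_−}(u)`, with `P_−` the small inward shrinking of `P`. -/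
noncomputable def sharpInt (Δ : LMultiFan n d) (c : Fin d → ℝ)
    (uu : Finset (Fin d) → Fin d → (Fin n → ℝ)) (ξ : Fin n → ℝ) : ℤ :=
  ∑ᶠ u : Fin n → ℤ, Δ.toMF.DH (fun i => c i - 1/2) uu ξ (fun k => (u k : ℝ))

end LMultiFan

open scoped Classical in
/-- The restriction `ι_I^*` over `ℂ`. -/
noncomputable def iotaC {n d : ℕ} (uu : Finset (Fin d) → Fin d → (Fin n → ℚ))
    (I : Finset (Fin d)) : MvPolynomial (Fin d) ℂ →ₐ[ℂ] MvPolynomial (Fin n) ℂ :=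
  MvPolynomial.aeval
    (fun i => if i ∈ I then ∑ k : Fin n, ((uu I i k : ℂ)) • MvPolynomial.X k else 0)

open scoped Classical in
/-- The index map `π_!` over `ℂ`. -/
noncomputable def piShriekC {n d : ℕ} (Δ : LMultiFan n d)
    (uu : Finset (Fin d) → Fin d → (Fin n → ℚ)) (x : MvPolynomial (Fin d) ℂ) :
    FractionRing (MvPolynomial (Fin n) ℂ) :=
  ∑ I ∈ Δ.S.filter (fun I => I.card = n),
    algebraMap (MvPolynomial (Fin n) ℂ) (FractionRing (MvPolynomial (Fin n) ℂ))
      (MvPolynomial.C ((Δ.w I : ℂ) /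
        (Nat.card ((Fin n → ℤ) ⧸ Submodule.span ℤ (Δ.v '' (I : Set (Fin d)))) : ℂ))) *
    (algebraMap (MvPolynomial (Fin n) ℂ) _ (iotaC uu I x) /
     algebraMap (MvPolynomial (Fin n) ℂ) _
       (∏ i ∈ I, ∑ k : Fin n, ((uu I i k : ℂ)) • MvPolynomial.X k))

/-- `G_Δ = ∪_{I∈Σ^{(n)}} G_I ⊆ ℝ^d/ℤ^d`, realized by its canonical representatives in
`[0,1)^d`: the classes `[a]` with `a_j = 0` off some `I ∈ Σ^{(n)}` and `∑_{i∈I} a_i v_i ∈ N`. -/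
def GD {n d : ℕ} (Δ : LMultiFan n d) : Set (Fin d → ℝ) :=
  {a | (∀ i, 0 ≤ a i ∧ a i < 1) ∧
       ∃ I ∈ Δ.S, I.card = n ∧ (∀ j, j ∉ I → a j = 0) ∧
         ∀ k : Fin n, ∃ m : ℤ, (∑ i ∈ I, a i * (Δ.v i k : ℝ)) = (m : ℝ)}

/-- `ρ_i(g) = exp(2π√−1 a_i)` for `g = [a] ∈ ℝ^d/ℤ^d`. -/
noncomputable def rho {d : ℕ} (i : Fin d) (a : Fin d → ℝ) : ℂ :=
  Complex.exp (2 * (Real.pi : ℂ) * Complex.I * (a i : ℂ))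

/-- `td ρ k` is the `k`-th Maclaurin coefficient of the Todd series `x/(1 − ρ e^{−x})`,
characterized for `k ≤ n` by the identity
`(∑_k td ρ k x^k)(1 − ρ e^{−x}) ≡ x  (mod x^{n+2})`. -/
def ToddCoeffs (n : ℕ) (td : ℂ → ℕ → ℂ) : Prop :=
  ∀ ρ : ℂ, ∀ m : ℕ, m ≤ n + 1 →
    (∑ k ∈ Finset.range (m+1), td ρ k *
      (if m - k = 0 then 1 - ρ else -ρ * (-1 : ℂ)^(m-k) / ((Nat.factorial (m-k) : ℂ))))
    = (if m = 1 then 1 else 0)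

/-- The Todd class `T(Δ) = ∑_{g∈G_Δ} ∏_i x_i/(1 − ρ_i(g)e^{−x_i})` of the multi-fan,
truncated at degree `n` in each variable (which suffices to determine all components of
total degree `≤ n`, the only ones surviving in `H^*(Δ)`). -/
noncomputable def toddPoly {n d : ℕ} (Δ : LMultiFan n d) (td : ℂ → ℕ → ℂ) :
    MvPolynomial (Fin d) ℂ :=
  ∑ᶠ a : ↥(GD Δ), ∏ i : Fin d,
    ∑ k ∈ Finset.range (n+1), td (rho i (a : Fin d → ℝ)) k • MvPolynomial.X i ^ k

/-- `e^{c_1^T(P)} = ∏_i e^{c_i x_i}`, truncated at degree `n` in each variable. -/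
noncomputable def expPoly (n : ℕ) {d : ℕ} (c : Fin d → ℝ) : MvPolynomial (Fin d) ℂ :=
  ∏ i : Fin d, ∑ k ∈ Finset.range (n+1),
    (((c i : ℂ)) ^ k / (Nat.factorial k : ℂ)) • MvPolynomial.X i ^ k


/-- One-dimensional signed indicator. -/
noncomputable def sg (y c x : ℝ) : ℝ :=
  if 0 < y then (if c ≤ x then -1 else 0) else (if x ≤ c then 1 else 0)

lemma sg_abs_le (y c x : ℝ) : |sg y c x| ≤ 1 := by
  unfold sg; split_ifs <;> simp

lemma sg_measurable (y c : ℝ) : Measurable (sg y c) := by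
  unfold sg
  split_ifs
  · exact Measurable.ite measurableSet_Ici measurable_const measurable_const
  · exact Measurable.ite measurableSet_Iic measurable_const measurable_const

lemma sg_eq (y c x : ℝ) (hx : x ≠ c) :
    sg y c x = (if 0 < y then 0 else 1) - (if c < x then 1 else 0) := by
  unfold sg
  rcases lt_or_gt_of_ne hx with h | h
  · simp [h.le, not_le.2 h, not_lt.2 h.le]
  · simp [h.le, not_le.2 h, h]; split_ifs <;> simp

lemma sg_shift (y c x z : ℝ) : sg y (c + z) (c + x) = sg y z x := by
  unfold sg; simp

lemma sg_integral (y c s : ℝ) (hy : y ≠ 0) (hs : s < 0) :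
    MeasureTheory.Integrable (fun x => sg y c x * Real.exp (s * y * x)) ∧
    ∫ x, sg y c x * Real.exp (s * y * x) = Real.exp (s * (c * y)) / (s * y) := by
  rcases lt_or_gt_of_ne hy with h | h
  · have h1 : 0 < s * y := mul_pos_of_neg_of_neg hs h
    have : (fun x => sg y c x * Real.exp (s * y * x)) =
        Set.indicator (Set.Iic c) (fun x => Real.exp (s * y * x)) := by
      ext x; unfold sg; simp [not_lt.2 h.le, Set.indicator]
    rw [this]
    refine ⟨(MeasureTheory.integrable_indicator_iff measurableSet_Iic).2
      (integrableOn_exp_mul_Iic h1 c), ?_⟩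
    rw [MeasureTheory.integral_indicator measurableSet_Iic, integral_exp_mul_Iic h1]
    ring_nf
  · have h1 : s * y < 0 := mul_neg_of_neg_of_pos hs h
    have : (fun x => sg y c x * Real.exp (s * y * x)) =
        Set.indicator (Set.Ici c) (fun x => - Real.exp (s * y * x)) := by
      ext x; unfold sg; simp [h, Set.indicator]
    rw [this]
    refine ⟨(MeasureTheory.integrable_indicator_iff measurableSet_Ici).2
      ((integrableOn_Ici_iff_integrableOn_Ioi).2 (integrableOn_exp_mul_Ioi h1 c).neg), ?_⟩
    rw [MeasureTheory.integral_indicator measurableSet_Ici, MeasureTheory.integral_Ici_eq_integral_Ioi,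
      MeasureTheory.integral_neg, integral_exp_mul_Ioi h1]
    ring_nf

lemma hasSum_of_eq {β : Type*} {f g : β → ℂ} {a b : ℂ} (h : HasSum f a)
    (hf : ∀ x, g x = f x) (hb : b = a) : HasSum g b := by
  rw [hb, funext hf]; exact h

lemma sg_hasSum (y s : ℝ) (hy : y ≠ 0) (hs : s < 0) (r : ℂ) (hr : ‖r‖ = 1) :
    HasSum (fun m : ℤ => (sg y (1/2) m : ℂ) * (r ^ (-m) * Complex.exp (s * y * m)))
      (1 / (1 - r * Complex.exp (-(s * y)))) := by
  have hr0 : r ≠ 0 := by rintro rfl; simp at hr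
  rcases lt_or_gt_of_ne hy with h | h
  · have h1 : 0 < s * y := mul_pos_of_neg_of_neg hs h
    have hinj : Function.Injective (fun k : ℕ => -(k : ℤ)) := fun a b hab => by simpa using hab
    rw [← hinj.hasSum_iff]
    · have hn : ‖r * Complex.exp (-(s * y))‖ < 1 := by
        rw [norm_mul, hr, one_mul, Complex.norm_exp]
        simpa using h1
      refine hasSum_of_eq (hasSum_geometric_of_norm_lt_one hn) ?_ ?_
      · intro k
        have : sg y (1/2) ((-(k : ℤ) : ℤ) : ℝ) = 1 := by
          unfold sg
          have : -(k : ℝ) ≤ 1/2 := by have := Nat.cast_nonneg (α := ℝ) k; linarith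
          simp [not_lt.2 h.le]
          simpa using this
        simp only [Function.comp]
        rw [this, mul_pow, ← Complex.exp_nat_mul]
        simp
        ring_nf
        simp
      · simp
    · intro m hm
      have : 0 < m := by
        by_contra hc
        push Not at hc
        exact hm ⟨(-m).toNat, by show -(((-m).toNat : ℕ) : ℤ) = m; omega⟩
      have h2 : (1 : ℝ) ≤ m := by exact_mod_cast this
      have : sg y (1/2) m = 0 := by
        unfold sg
        rw [if_neg (not_lt.2 h.le), if_neg (by linarith)]
      rw [this]; simp
  · have h1 : s * y < 0 := mul_neg_of_neg_of_pos hs h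
    have hinj : Function.Injective (fun k : ℕ => (k : ℤ) + 1) := fun a b hab => by simpa using hab
    rw [← hinj.hasSum_iff]
    · have hn : ‖r⁻¹ * Complex.exp (s * y)‖ < 1 := by
        rw [norm_mul, norm_inv, hr, inv_one, one_mul, Complex.norm_exp]
        simpa using h1
      have := (hasSum_geometric_of_norm_lt_one hn).mul_left (-(r⁻¹ * Complex.exp (s * y)))
      have hne : 1 - r⁻¹ * Complex.exp (s * y) ≠ 0 := by
        intro h0
        rw [← sub_eq_zero.1 h0] at hn
        simp at hn
      refine hasSum_of_eq this ?_ ?_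
      · intro k
        have : sg y (1/2) (((k : ℤ) + 1 : ℤ) : ℝ) = -1 := by
          unfold sg
          have : (1 : ℝ)/2 ≤ k + 1 := by have := Nat.cast_nonneg (α := ℝ) k; linarith
          rw [if_pos h, if_pos]
          push_cast; exact this
        simp only [Function.comp]
        rw [this, mul_pow, ← Complex.exp_nat_mul, neg_mul, mul_mul_mul_comm, ← Complex.exp_add,
          ← pow_succ', zpow_neg]
        push_cast
        rw [show ((k : ℤ) + 1) = ((k + 1 : ℕ) : ℤ) by simp, zpow_natCast]
        simp
        ring_nf
        simp
      · rw [Complex.exp_neg] at *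
        have he := Complex.exp_ne_zero (s * y)
        rw [show (1 - r * (Complex.exp (s * y))⁻¹) =
          -(1 - r⁻¹ * Complex.exp (s * y)) * (r * (Complex.exp (s * y))⁻¹) by field_simp; ring]
        field_simp
    · intro m hm
      have : m ≤ 0 := by
        by_contra hc
        push Not at hc
        exact hm ⟨(m - 1).toNat, by show (((m - 1).toNat : ℕ) : ℤ) + 1 = m; omega⟩
      have h2 : (m : ℝ) ≤ 0 := by exact_mod_cast this
      have : sg y (1/2) m = 0 := by
        unfold sg
        rw [if_pos h, if_neg (by linarith)]
      rw [this]; simp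

lemma hasSum_mul_pair {α β : Type*} {f : α → ℂ} {g : β → ℂ} {a b : ℂ} (hf : HasSum f a)
    (hg : HasSum g b) : HasSum (fun x : α × β => f x.1 * g x.2) (a * b) :=
  hf.mul hg (summable_mul_of_summable_norm hf.summable.norm hg.summable.norm)

lemma hasSum_pi_fin (n : ℕ) (f : Fin n → ℤ → ℂ) (S : Fin n → ℂ)
    (h : ∀ i, HasSum (f i) (S i)) :
    HasSum (fun m : Fin n → ℤ => ∏ i, f i (m i)) (∏ i, S i) := by
  induction n with
  | zero =>
    simp only [Finset.univ_eq_empty, Finset.prod_empty]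
    exact hasSum_unique (fun _ : Fin 0 → ℤ => (1 : ℂ))
  | succ n ih =>
    have h1 := ih (fun i => f i.succ) (fun i => S i.succ) (fun i => h _)
    have h2 := hasSum_mul_pair (h 0) h1
    rw [Fin.prod_univ_succ, ← (Fin.consEquiv (fun _ => ℤ)).hasSum_iff]
    refine hasSum_of_eq h2 ?_ rfl
    rintro ⟨a, b⟩
    simp [Fin.prod_univ_succ, Fin.consEquiv]

/-- `V` integral vectors with dual basis `U`. -/
def DualPair {n : ℕ} (V : Fin n → Fin n → ℤ) (U : Fin n → Fin n → ℝ) : Prop :=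
  ∀ i j, dotp (U i) (fun k => (V j k : ℝ)) = if i = j then 1 else 0

/-- The real matrix of `V`. -/
def VM {n : ℕ} (V : Fin n → Fin n → ℤ) : Matrix (Fin n) (Fin n) ℝ :=
  Matrix.of (fun i k => (V i k : ℝ))

section loc
variable {n : ℕ} {V : Fin n → Fin n → ℤ} {U : Fin n → Fin n → ℝ}

lemma DualPair.mat (h : DualPair V U) : Matrix.of U * (VM V).transpose = 1 := by
  ext i j
  simpa [Matrix.mul_apply, VM, Matrix.one_apply, dotp] using h i j

lemma DualPair.mat' (h : DualPair V U) : (VM V).transpose * Matrix.of U = 1 :=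
  mul_eq_one_comm.1 h.mat

lemma DualPair.dual (h : DualPair V U) (k l : Fin n) :
    ∑ i, (V i k : ℝ) * U i l = if k = l then 1 else 0 := by
  have := congrFun (congrFun h.mat' k) l
  simpa [Matrix.mul_apply, VM, Matrix.one_apply] using this

lemma DualPair.expand (h : DualPair V U) (x : Fin n → ℝ) (k : Fin n) :
    ∑ i, dotp (U i) x * (V i k : ℝ) = x k := by
  unfold dotp
  simp_rw [Finset.sum_mul]
  rw [Finset.sum_comm]
  calc _ = ∑ l, x l * ∑ i, (V i k : ℝ) * U i l := by
        refine Finset.sum_congr rfl fun l _ => ?_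
        rw [Finset.mul_sum]
        exact Finset.sum_congr rfl fun i _ => by ring
    _ = x k := by simp [h.dual]

lemma DualPair.expand' (h : DualPair V U) (u : Fin n → ℝ) (l : Fin n) :
    ∑ i, dotp u (fun k => (V i k : ℝ)) * U i l = u l := by
  unfold dotp
  simp_rw [Finset.sum_mul]
  rw [Finset.sum_comm]
  calc _ = ∑ k, u k * ∑ i, (V i k : ℝ) * U i l := by
        refine Finset.sum_congr rfl fun l _ => ?_
        rw [Finset.mul_sum]
        exact Finset.sum_congr rfl fun i _ => by ring
    _ = u l := by simp [h.dual]

lemma DualPair.pairing (h : DualPair V U) (u x : Fin n → ℝ) :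
    dotp u x = ∑ i, dotp (U i) x * dotp u (fun k => (V i k : ℝ)) := by
  conv_lhs => unfold dotp
  conv_lhs => enter [2, k]; rw [← h.expand x k, Finset.mul_sum]
  rw [Finset.sum_comm]
  refine Finset.sum_congr rfl fun i _ => ?_
  conv_rhs => enter [2]; unfold dotp
  rw [Finset.mul_sum]
  exact Finset.sum_congr rfl fun k _ => by ring

lemma DualPair.det_ne (h : DualPair V U) : (VM V).det ≠ 0 := by
  have := congrArg Matrix.det h.mat
  rw [Matrix.det_mul, Matrix.det_transpose, Matrix.det_one] at this
  exact right_ne_zero_of_mul_eq_one this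

lemma local_integral (h : DualPair V U) (ξ c : Fin n → ℝ) (hξ : ∀ i, dotp (U i) ξ ≠ 0)
    (s : ℝ) (hs : s < 0) :
    MeasureTheory.Integrable (fun u : Fin n → ℝ =>
      (∏ i, sg (dotp (U i) ξ) (c i) (dotp u (fun k => (V i k : ℝ)))) * Real.exp (s * dotp u ξ)) ∧
    ∫ u : Fin n → ℝ,
      (∏ i, sg (dotp (U i) ξ) (c i) (dotp u (fun k => (V i k : ℝ)))) * Real.exp (s * dotp u ξ) =
    |(VM V).det|⁻¹ * (Real.exp (s * ∑ i, c i * dotp (U i) ξ) * ∏ i, (1 / (s * dotp (U i) ξ))) := by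
  let g : (Fin n → ℝ) → ℝ := fun r => ∏ i, (fun x => sg (dotp (U i) ξ) (c i) x *
    Real.exp (s * dotp (U i) ξ * x)) (r i)
  let f := Matrix.toLin' (VM V)
  have hf : Measurable f := f.continuous_of_finiteDimensional.measurable
  have hg : Measurable g := by
    refine Finset.measurable_prod _ fun i _ => ?_
    have := sg_measurable (dotp (U i) ξ) (c i)
    fun_prop
  have hgi : MeasureTheory.Integrable g :=
    MeasureTheory.Integrable.fintype_prod fun i => (sg_integral _ (c i) s (hξ i) hs).1
  have hEq : (fun u : Fin n → ℝ =>
      (∏ i, sg (dotp (U i) ξ) (c i) (dotp u (fun k => (V i k : ℝ)))) * Real.exp (s * dotp u ξ))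
      = g ∘ f := by
    ext u
    have hfu : ∀ i, f u i = dotp u (fun k => (V i k : ℝ)) := by
      intro i
      simp only [f, Matrix.toLin'_apply, Matrix.mulVec, dotProduct, VM, dotp, Matrix.of_apply]
      exact Finset.sum_congr rfl fun k _ => mul_comm _ _
    simp only [Function.comp, g, hfu, Finset.prod_mul_distrib]
    rw [h.pairing u ξ, Finset.mul_sum, Real.exp_sum]
    simp_rw [mul_assoc]
  have hmap := Real.map_matrix_volume_pi_eq_smul_volume_pi h.det_ne
  rw [hEq]
  constructor
  · rw [← MeasureTheory.integrable_map_measure hg.aestronglyMeasurable hf.aemeasurable]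
    simp only [f]
    rw [hmap]
    exact hgi.smul_measure (by simp)
  · change ∫ u, g (f u) = _
    rw [← MeasureTheory.integral_map hf.aemeasurable hg.aestronglyMeasurable]
    simp only [f]
    rw [hmap, MeasureTheory.integral_smul_measure]
    have hgint : ∫ r, g r = ∏ i, ∫ x, sg (dotp (U i) ξ) (c i) x *
        Real.exp (s * dotp (U i) ξ * x) :=
      MeasureTheory.integral_fintype_prod_volume_eq_prod (fun i x => sg (dotp (U i) ξ) (c i) x *
        Real.exp (s * dotp (U i) ξ * x))
    rw [hgint]
    simp_rw [(sg_integral _ (c _) s (hξ _) hs).2]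
    rw [Finset.mul_sum, Real.exp_sum, ← Finset.prod_mul_distrib, abs_inv,
      ENNReal.toReal_ofReal (by positivity), smul_eq_mul]
    congr 1
    exact Finset.prod_congr rfl fun i _ => by ring

end loc

/-- Local group. -/
def GLoc {n : ℕ} (V : Fin n → Fin n → ℤ) : Set (Fin n → ℝ) :=
  {a | (∀ i, 0 ≤ a i ∧ a i < 1) ∧ ∀ k : Fin n, ∃ m : ℤ, (∑ i, a i * (V i k : ℝ)) = (m : ℝ)}

/-- The standard character. -/
noncomputable def e1 (x : ℝ) : ℂ := Complex.exp (2 * (Real.pi : ℂ) * Complex.I * (x : ℂ))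

lemma e1_add (x y : ℝ) : e1 (x + y) = e1 x * e1 y := by
  unfold e1; rw [← Complex.exp_add]; push_cast; ring_nf

lemma e1_norm (x : ℝ) : ‖e1 x‖ = 1 := by
  unfold e1
  rw [show 2 * (Real.pi : ℂ) * Complex.I * (x : ℂ) = ((2 * Real.pi * x : ℝ) : ℂ) * Complex.I by
    push_cast; ring]
  exact Complex.norm_exp_ofReal_mul_I _

lemma e1_eq_one (x : ℝ) : e1 x = 1 ↔ ∃ m : ℤ, x = m := by
  unfold e1
  rw [Complex.exp_eq_one_iff]
  refine exists_congr fun m => ?_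
  have h : (2 * (Real.pi : ℂ) * Complex.I) ≠ 0 := Complex.two_pi_I_ne_zero
  rw [mul_comm (m : ℂ)]
  constructor
  · intro h2
    exact_mod_cast mul_left_cancel₀ h h2
  · rintro rfl; simp

lemma e1_int (m : ℤ) : e1 m = 1 := (e1_eq_one _).2 ⟨m, rfl⟩

lemma e1_zpow (x : ℝ) (m : ℤ) : e1 x ^ m = e1 (x * m) := by
  unfold e1; rw [← Complex.exp_int_mul]; push_cast; ring_nf

lemma e1_sum {ι : Type*} (t : Finset ι) (f : ι → ℝ) : e1 (∑ i ∈ t, f i) = ∏ i ∈ t, e1 (f i) := by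
  unfold e1; push_cast; rw [Finset.mul_sum, Complex.exp_sum]

lemma e1_fract (x : ℝ) : e1 (Int.fract x) = e1 x := by
  conv_rhs => rw [← Int.fract_add_floor x, e1_add, e1_int, mul_one]

section loc
variable {n : ℕ} {V : Fin n → Fin n → ℤ} {U : Fin n → Fin n → ℝ}

/-- Reduction of an integral vector. -/
noncomputable def redu (U : Fin n → Fin n → ℝ) (x : Fin n → ℤ) : Fin n → ℝ :=
  fun i => Int.fract (dotp (U i) (fun k => (x k : ℝ)))

lemma fract_sum_int (V : Fin n → Fin n → ℤ) (a : Fin n → ℝ) (k : Fin n)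
    (h : ∃ m : ℤ, ∑ i, a i * (V i k : ℝ) = m) :
    ∃ m : ℤ, ∑ i, Int.fract (a i) * (V i k : ℝ) = m := by
  obtain ⟨m, hm⟩ := h
  refine ⟨m - ∑ i, ⌊a i⌋ * V i k, ?_⟩
  push_cast
  rw [← hm, ← Finset.sum_sub_distrib]
  refine Finset.sum_congr rfl fun i _ => ?_
  rw [← Int.self_sub_floor]; ring

lemma redu_mem (h : DualPair V U) (x : Fin n → ℤ) : redu U x ∈ GLoc V := by
  refine ⟨fun i => ⟨Int.fract_nonneg _, Int.fract_lt_one _⟩, fun k => ?_⟩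
  exact fract_sum_int V _ k ⟨x k, h.expand _ k⟩

lemma redu_surj (h : DualPair V U) (a : Fin n → ℝ) (ha : a ∈ GLoc V) :
    ∃ x, redu U x = a := by
  choose x hx using ha.2
  refine ⟨x, ?_⟩
  funext i
  have : dotp (U i) (fun k => (x k : ℝ)) = a i := by
    have h1 : (fun k => (x k : ℝ)) = fun k => ∑ j, a j * (V j k : ℝ) := by
      ext k; rw [hx]
    rw [h1]
    unfold dotp
    simp_rw [Finset.mul_sum]
    rw [Finset.sum_comm]
    calc _ = ∑ j, a j * dotp (U i) (fun k => (V j k : ℝ)) := by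
          refine Finset.sum_congr rfl fun j _ => ?_
          unfold dotp
          rw [Finset.mul_sum]
          exact Finset.sum_congr rfl fun k _ => by ring
      _ = a i := by simp [h i]
  simp only [redu, this]
  exact Int.fract_eq_self.2 (ha.1 i)

lemma redu_eq_iff (h : DualPair V U) (x y : Fin n → ℤ) :
    redu U x = redu U y ↔ x - y ∈ Submodule.span ℤ (Set.range V) := by
  rw [Submodule.mem_span_range_iff_exists_fun]
  have hd : ∀ i, dotp (U i) (fun k => (x k : ℝ)) - dotp (U i) (fun k => (y k : ℝ))
      = dotp (U i) (fun k => ((x - y) k : ℝ)) := by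
    intro i
    unfold dotp
    rw [← Finset.sum_sub_distrib]
    exact Finset.sum_congr rfl fun k _ => by simp; ring
  constructor
  · intro hxy
    have h1 : ∀ i, ∃ z : ℤ, dotp (U i) (fun k => ((x - y) k : ℝ)) = z := by
      intro i
      obtain ⟨z, hz⟩ := Int.fract_eq_fract.1 (congrFun hxy i)
      exact ⟨z, by rw [← hd, hz]⟩
    choose z hz using h1
    refine ⟨z, ?_⟩
    funext k
    have := h.expand (fun k => ((x - y) k : ℝ)) k
    simp_rw [hz] at this
    simp only [Finset.sum_apply, Pi.smul_apply, smul_eq_mul]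
    exact_mod_cast this
  · rintro ⟨z, hz⟩
    funext i
    refine Int.fract_eq_fract.2 ⟨z i, ?_⟩
    rw [hd, ← hz]
    unfold dotp
    simp only [Finset.sum_apply, Pi.smul_apply, smul_eq_mul, Int.cast_sum, Int.cast_mul]
    simp_rw [Finset.mul_sum]
    rw [Finset.sum_comm]
    calc _ = ∑ j, (z j : ℝ) * dotp (U i) (fun k => (V j k : ℝ)) := by
          refine Finset.sum_congr rfl fun j _ => ?_
          unfold dotp
          rw [Finset.mul_sum]
          exact Finset.sum_congr rfl fun k _ => by ring
      _ = z i := by simp [h i]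

lemma GLoc_card (h : DualPair V U) : (Nat.card (GLoc V) : ℝ) = |(VM V).det| := by
  have hdet : (VM V).det = ((Matrix.of V).det : ℝ) := by
    have : VM V = (Matrix.of V).map (Int.castRingHom ℝ) := by ext; rfl
    rw [this, ← RingHom.mapMatrix_apply, ← RingHom.map_det]; rfl
  have hli : LinearIndependent ℤ V := by
    have hd : (Matrix.of V).det ≠ 0 := by
      have := h.det_ne
      rw [hdet] at this
      exact_mod_cast this
    exact Matrix.linearIndependent_rows_of_det_ne_zero hd
  let N := Submodule.span ℤ (Set.range V)
  let bN := Module.Basis.span hli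
  have h1 := Submodule.natAbs_det_basis_change (Pi.basisFun ℤ (Fin n)) N bN
  have h2 : ((↑) ∘ bN : Fin n → (Fin n → ℤ)) = V := by
    ext i k
    simp only [Function.comp, bN]
    rw [Module.Basis.span_apply]
  rw [h2] at h1
  have h3 : Nat.card (GLoc V) = Nat.card ((Fin n → ℤ) ⧸ N) := by
    let f : (Fin n → ℤ) ⧸ N → GLoc V := fun q => Quotient.liftOn' q
      (fun x => ⟨redu U x, redu_mem h x⟩) (fun x y hxy => by
        have := (Submodule.quotientRel_def N).1 hxy
        exact Subtype.ext ((redu_eq_iff h x y).2 this))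
    refine (Nat.card_congr (Equiv.ofBijective f ⟨?_, ?_⟩)).symm
    · intro p q
      refine Quotient.inductionOn₂' p q fun x y hxy => ?_
      have : redu U x = redu U y := congrArg Subtype.val hxy
      exact Quotient.sound' ((Submodule.quotientRel_def N).2 ((redu_eq_iff h x y).1 this))
    · rintro ⟨a, ha⟩
      obtain ⟨x, rfl⟩ := redu_surj h a ha
      exact ⟨Quotient.mk'' x, rfl⟩
  rw [h3, ← h1, hdet, ← Int.cast_abs, Nat.cast_natAbs]
  congr 2
  rw [Pi.basisFun_det_apply]

lemma GLoc_finite (h : DualPair V U) : (GLoc V).Finite := by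
  have : Nat.card (GLoc V) ≠ 0 := by
    have := GLoc_card h
    intro h0
    rw [h0] at this
    exact h.det_ne (by simpa using this.symm)
  exact Set.finite_coe_iff.1 (Nat.finite_of_card_ne_zero this)

/-- The pairing character. -/
noncomputable def chi (a : Fin n → ℝ) (m : Fin n → ℤ) : ℂ := ∏ i, e1 (a i) ^ (-(m i))

lemma chi_eq (a : Fin n → ℝ) (m : Fin n → ℤ) : chi a m = e1 (-∑ i, a i * m i) := by
  unfold chi
  rw [← Finset.sum_neg_distrib, e1_sum]
  refine Finset.prod_congr rfl fun i _ => ?_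
  rw [e1_zpow]; push_cast; ring_nf

lemma chi_fract_add (a b : Fin n → ℝ) (m : Fin n → ℤ) :
    chi (fun i => Int.fract (a i + b i)) m = chi a m * chi b m := by
  unfold chi
  rw [← Finset.prod_mul_distrib]
  refine Finset.prod_congr rfl fun i _ => ?_
  rw [e1_fract, e1_add, mul_zpow]

/-- The integral pairing map. -/
def pairV (V : Fin n → Fin n → ℤ) (u : Fin n → ℤ) : Fin n → ℤ := fun i => ∑ k, u k * V i k

lemma pairV_cast (V : Fin n → Fin n → ℤ) (u : Fin n → ℤ) (i : Fin n) :
    ((pairV V u i : ℤ) : ℝ) = dotp (fun k => (u k : ℝ)) (fun k => (V i k : ℝ)) := by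
  unfold pairV dotp; push_cast; rfl

lemma pairV_inj (h : DualPair V U) : Function.Injective (pairV V) := by
  intro u u' huu
  funext l
  have h1 := h.expand' (fun k => (u k : ℝ)) l
  have h2 := h.expand' (fun k => (u' k : ℝ)) l
  simp_rw [← pairV_cast] at h1 h2
  rw [huu, h2] at h1
  exact_mod_cast h1.symm

lemma chi_range (a : Fin n → ℝ) (ha : a ∈ GLoc V) (u : Fin n → ℤ) : chi a (pairV V u) = 1 := by
  rw [chi_eq, e1_eq_one]
  choose z hz using ha.2
  refine ⟨-∑ k, u k * z k, ?_⟩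
  push_cast
  congr 1
  simp_rw [← hz, pairV, Finset.mul_sum]
  push_cast
  simp_rw [Finset.mul_sum]
  rw [Finset.sum_comm]
  exact Finset.sum_congr rfl fun _ _ => Finset.sum_congr rfl fun _ _ => by ring

lemma exists_chi (h : DualPair V U) (m : Fin n → ℤ) (hm : m ∉ Set.range (pairV V)) :
    ∃ a ∈ GLoc V, chi a m ≠ 1 := by
  by_contra hc
  push Not at hc
  apply hm
  have h1 : ∀ k, ∃ z : ℤ, ∑ i, U i k * m i = z := by
    intro k
    have h2 := hc _ (redu_mem h (Pi.single k 1))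
    have h3 : chi (redu U (Pi.single k 1)) m = e1 (-∑ i, U i k * m i) := by
      rw [← chi_eq (fun i => U i k)]
      unfold chi redu
      refine Finset.prod_congr rfl fun i _ => ?_
      rw [e1_fract]
      congr 2
      simp [dotp, Pi.single_apply]
    rw [h3, e1_eq_one] at h2
    obtain ⟨z, hz⟩ := h2
    exact ⟨-z, by push_cast; linarith⟩
  choose z hz using h1
  refine ⟨z, ?_⟩
  funext i
  have : ((pairV V z i : ℤ) : ℝ) = m i := by
    unfold pairV
    push_cast
    simp_rw [← hz, Finset.sum_mul]
    rw [Finset.sum_comm]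
    calc _ = ∑ j, (m j : ℝ) * dotp (U j) (fun k => (V i k : ℝ)) := by
          refine Finset.sum_congr rfl fun j _ => ?_
          unfold dotp
          rw [Finset.mul_sum]
          exact Finset.sum_congr rfl fun k _ => by ring
      _ = m i := by simp [h _ i]
  exact_mod_cast this

lemma orthog (h : DualPair V U) (m : Fin n → ℤ) (hm : m ∉ Set.range (pairV V)) :
    ∑ a ∈ (GLoc_finite h).toFinset, chi a m = 0 := by
  obtain ⟨b, hb, hbm⟩ := exists_chi h m hm
  set T := (GLoc_finite h).toFinset with hT
  let σ : (Fin n → ℝ) → (Fin n → ℝ) := fun a i => Int.fract (a i + b i)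
  have hmaps : ∀ a ∈ T, σ a ∈ T := by
    intro a ha
    rw [hT, Set.Finite.mem_toFinset] at ha ⊢
    refine ⟨fun i => ⟨Int.fract_nonneg _, Int.fract_lt_one _⟩, fun k => ?_⟩
    refine fract_sum_int V _ k ?_
    obtain ⟨z, hz⟩ := ha.2 k
    obtain ⟨z', hz'⟩ := hb.2 k
    refine ⟨z + z', ?_⟩
    push_cast
    rw [← hz, ← hz', ← Finset.sum_add_distrib]
    exact Finset.sum_congr rfl fun i _ => by ring
  have hinj : ∀ a ∈ T, ∀ a' ∈ T, σ a = σ a' → a = a' := by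
    intro a ha a' ha' haa
    rw [hT, Set.Finite.mem_toFinset] at ha ha'
    funext i
    obtain ⟨z, hz⟩ := Int.fract_eq_fract.1 (congrFun haa i)
    have h1 := ha.1 i
    have h2 := ha'.1 i
    have h3 : a i - a' i = z := by rw [← hz]; ring
    have h4 : (-1 : ℝ) < z := by rw [← h3]; linarith
    have h5 : (z : ℝ) < 1 := by rw [← h3]; linarith
    have h6 : z = 0 := by
      have : -1 < z := by exact_mod_cast h4
      have : z < 1 := by exact_mod_cast h5
      omega
    rw [h6] at h3
    push_cast at h3
    linarith
  have himg : T.image σ = T := by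
    apply Finset.eq_of_subset_of_card_le
    · intro x hx
      obtain ⟨a, ha, rfl⟩ := Finset.mem_image.1 hx
      exact hmaps a ha
    · rw [Finset.card_image_of_injOn (fun a ha a' ha' => hinj a ha a' ha')]
  have h1 : ∑ a ∈ T, chi a m = (∑ a ∈ T, chi a m) * chi b m := by
    conv_lhs => rw [← himg, Finset.sum_image (fun a ha a' ha' => hinj a ha a' ha')]
    rw [Finset.sum_mul]
    exact Finset.sum_congr rfl fun a _ => chi_fract_add a b m
  have h2 : (∑ a ∈ T, chi a m) * (chi b m - 1) = 0 := by
    rw [mul_sub, ← h1]; ring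
  exact (mul_eq_zero.1 h2).resolve_right (sub_ne_zero.2 hbm)

lemma local_sum (h : DualPair V U) (ξ c : Fin n → ℝ) (hξ : ∀ i, dotp (U i) ξ ≠ 0)
    (hc : ∀ k, ∃ m : ℤ, ∑ i, c i * U i k = m) (s : ℝ) (hs : s < 0) :
    HasSum (fun u : Fin n → ℤ =>
      (((∏ i, sg (dotp (U i) ξ) (c i + 1/2) (dotp (fun k => (u k : ℝ)) (fun k => (V i k : ℝ)))) *
        Real.exp (s * dotp (fun k => (u k : ℝ)) ξ) : ℝ) : ℂ))
      ((((|(VM V).det| : ℝ) : ℂ))⁻¹ * (Complex.exp (s * ∑ i, c i * dotp (U i) ξ) *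
        ∑ a ∈ (GLoc_finite h).toFinset,
          ∏ i, (1 / (1 - e1 (a i) * Complex.exp (-(s * dotp (U i) ξ)))))) := by
  choose u0 hu0 using hc
  set y : Fin n → ℝ := fun i => dotp (U i) ξ with hy
  have hD : ((|(VM V).det| : ℝ) : ℂ) ≠ 0 := by
    simpa using h.det_ne
  have hcard : (((GLoc_finite h).toFinset.card : ℕ) : ℂ) = ((|(VM V).det| : ℝ) : ℂ) := by
    rw [← GLoc_card h, Nat.card_eq_card_finite_toFinset (GLoc_finite h)]; simp
  -- pairing of the vertex
  have hv0 : ∀ i, dotp (fun k => (u0 k : ℝ)) (fun k => (V i k : ℝ)) = c i := by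
    intro i
    unfold dotp
    simp_rw [← hu0, Finset.sum_mul]
    rw [Finset.sum_comm]
    calc _ = ∑ j, c j * dotp (U j) (fun k => (V i k : ℝ)) := by
          refine Finset.sum_congr rfl fun j _ => ?_
          unfold dotp
          rw [Finset.mul_sum]
          exact Finset.sum_congr rfl fun k _ => by ring
      _ = c i := by simp [h _ i]
  -- the full sum
  let F : (Fin n → ℤ) → ℂ := fun m => (((|(VM V).det| : ℝ) : ℂ)⁻¹ *
    (Complex.exp (s * ∑ i, c i * y i) *
      ∑ a ∈ (GLoc_finite h).toFinset, ∏ i, ((sg (y i) (1/2) (m i) : ℂ) *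
        (e1 (a i) ^ (-(m i)) * Complex.exp (s * y i * m i)))))
  have hF : HasSum F ((((|(VM V).det| : ℝ) : ℂ)⁻¹ * (Complex.exp (s * ∑ i, c i * y i) *
        ∑ a ∈ (GLoc_finite h).toFinset,
          ∏ i, (1 / (1 - e1 (a i) * Complex.exp (-(s * y i))))))) := by
    refine HasSum.mul_left _ (HasSum.mul_left _ (hasSum_sum fun a _ => ?_))
    exact hasSum_pi_fin n (fun i m => (sg (y i) (1/2) m : ℂ) *
        (e1 (a i) ^ (-m) * Complex.exp (s * y i * m))) _
      (fun i => sg_hasSum (y i) s (hξ i) hs _ (e1_norm _))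
  have hFm : ∀ m, F m = ((|(VM V).det| : ℝ) : ℂ)⁻¹ *
      (Complex.exp (s * ∑ i, c i * y i) * ((∏ i, ((sg (y i) (1/2) (m i) : ℂ) *
        Complex.exp (s * y i * m i))) * ∑ a ∈ (GLoc_finite h).toFinset, chi a m)) := by
    intro m
    simp only [F]
    congr 2
    rw [Finset.mul_sum]
    refine Finset.sum_congr rfl fun a _ => ?_
    unfold chi
    rw [← Finset.prod_mul_distrib]
    exact Finset.prod_congr rfl fun i _ => by ring
  rw [← (pairV_inj h).hasSum_iff (fun m hm => by rw [hFm, orthog h m hm]; simp)] at hF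
  rw [← (Equiv.addLeft u0).hasSum_iff]
  refine hasSum_of_eq hF ?_ (by rfl)
  intro u
  simp only [Function.comp]
  rw [hFm, Finset.sum_congr rfl (g := fun _ => (1 : ℂ)) (fun a ha => chi_range a
    ((Set.Finite.mem_toFinset _).1 ha) u), Finset.sum_const, nsmul_eq_mul, mul_one, hcard]
  have hadd : ∀ x : Fin n → ℝ, dotp (fun k => (((Equiv.addLeft u0) u k : ℤ) : ℝ)) x =
      dotp (fun k => (u0 k : ℝ)) x + dotp (fun k => (u k : ℝ)) x := by
    intro x
    unfold dotp
    rw [← Finset.sum_add_distrib]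
    exact Finset.sum_congr rfl fun k _ => by simp [add_mul]
  simp_rw [hadd, hv0, sg_shift]
  rw [h.pairing (fun k => (u0 k : ℝ)) ξ, h.pairing (fun k => (u k : ℝ)) ξ]
  simp_rw [hv0, ← pairV_cast]
  rw [mul_add, Real.exp_add]
  push_cast
  rw [Finset.mul_sum (f := fun i => (dotp (U i) ξ : ℂ) * ((pairV V u i : ℤ) : ℂ)), Complex.exp_sum,
    Finset.prod_mul_distrib]
  have e : (∑ i, (dotp (U i) ξ : ℂ) * (c i : ℂ)) = ∑ i, (c i : ℂ) * (y i : ℂ) :=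
    Finset.sum_congr rfl fun i _ => mul_comm _ _
  rw [e]
  simp_rw [← mul_assoc]
  field_simp
  ring

end loc

open Filter Topology Asymptotics

/-- Polynomial approximation to the left of `0`, up to order `N`. -/
def Approx (N : ℕ) (f : ℝ → ℂ) (p : Polynomial ℂ) : Prop :=
  (fun s : ℝ => f s - p.eval (s : ℂ)) =O[𝓝[<] (0 : ℝ)] fun s : ℝ => (s : ℂ) ^ N

/-- Truncated polynomial. -/
noncomputable def tp (N : ℕ) (a : ℕ → ℂ) : Polynomial ℂ :=
  ∑ k ∈ Finset.range N, Polynomial.C (a k) * Polynomial.X ^ k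

lemma tp_coeff (N : ℕ) (a : ℕ → ℂ) (m : ℕ) :
    (tp N a).coeff m = if m < N then a m else 0 := by
  simp [tp, Polynomial.coeff_X_pow]

lemma poly_bdd (p : Polynomial ℂ) :
    (fun s : ℝ => p.eval (s : ℂ)) =O[𝓝[<] (0 : ℝ)] fun _ : ℝ => (1 : ℂ) := by
  have h : Continuous (fun s : ℝ => p.eval (s : ℂ)) := by fun_prop
  exact ((h.tendsto 0).mono_left nhdsWithin_le_nhds).isBigO_one ℂ

lemma pow_bdd (N : ℕ) :
    (fun s : ℝ => (s : ℂ) ^ N) =O[𝓝[<] (0 : ℝ)] fun _ : ℝ => (1 : ℂ) := by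
  have h : Continuous (fun s : ℝ => (s : ℂ) ^ N) := by fun_prop
  exact ((h.tendsto 0).mono_left nhdsWithin_le_nhds).isBigO_one ℂ

lemma Approx.bdd {N : ℕ} {f : ℝ → ℂ} {p : Polynomial ℂ} (h : Approx N f p) :
    f =O[𝓝[<] (0 : ℝ)] fun _ : ℝ => (1 : ℂ) := by
  have := (h.trans (pow_bdd N)).add (poly_bdd p)
  simpa using this

lemma Approx.mul {N : ℕ} {f g : ℝ → ℂ} {p q : Polynomial ℂ} (hf : Approx N f p)
    (hg : Approx N g q) : Approx N (fun s => f s * g s) (p * q) := by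
  have h1 := IsBigO.mul hf hg.bdd
  have h2 := IsBigO.mul (poly_bdd p) hg
  have := h1.add (h2.congr_right (g₂ := fun s : ℝ => (s : ℂ) ^ N * 1) (fun s => by ring))
  refine (this.congr_left ?_).congr_right ?_
  · intro s; simp only [Polynomial.eval_mul]; ring
  · intro s; simp

lemma Approx.poly (N : ℕ) (p : Polynomial ℂ) : Approx N (fun s => p.eval (s : ℂ)) p := by
  unfold Approx; simpa using isBigO_zero _ _

lemma Approx.sum {ι : Type*} {N : ℕ} (t : Finset ι) {f : ι → ℝ → ℂ} {p : ι → Polynomial ℂ}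
    (h : ∀ i ∈ t, Approx N (f i) (p i)) :
    Approx N (fun s => ∑ i ∈ t, f i s) (∑ i ∈ t, p i) := by
  unfold Approx
  have := IsBigO.sum (s := t) h
  refine this.congr_left fun s => ?_
  simp only [Finset.sum_apply]
  rw [Polynomial.eval_finsetSum, Finset.sum_sub_distrib]

lemma Approx.prod {ι : Type*} {N : ℕ} (t : Finset ι) {f : ι → ℝ → ℂ} {p : ι → Polynomial ℂ}
    (h : ∀ i ∈ t, Approx N (f i) (p i)) :
    Approx N (fun s => ∏ i ∈ t, f i s) (∏ i ∈ t, p i) := by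
  classical
  induction t using Finset.induction_on with
  | empty => simpa using Approx.poly N 1
  | insert a t ha ih =>
    simp only [Finset.prod_insert ha]
    exact (h a (Finset.mem_insert_self _ _)).mul
      (ih fun i hi => h i (Finset.mem_insert_of_mem hi))

lemma Approx.const_mul {N : ℕ} (a : ℂ) {f : ℝ → ℂ} {p : Polynomial ℂ} (h : Approx N f p) :
    Approx N (fun s => a * f s) (Polynomial.C a * p) := by
  simpa using (Approx.poly N (Polynomial.C a)).mul h

lemma Approx.congr_poly {N : ℕ} {f : ℝ → ℂ} {p q : Polynomial ℂ} (h : Approx N f p)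
    (hpq : ∀ m < N, p.coeff m = q.coeff m) : Approx N f q := by
  obtain ⟨r, hr⟩ : Polynomial.X ^ N ∣ p - q := by
    rw [Polynomial.X_pow_dvd_iff]
    intro m hm
    rw [Polynomial.coeff_sub, hpq m hm, sub_self]
  have h1 : (fun s : ℝ => (p - q).eval (s : ℂ)) =O[𝓝[<] (0 : ℝ)] fun s : ℝ => (s : ℂ) ^ N := by
    rw [hr]
    have := (isBigO_refl (fun s : ℝ => (s : ℂ) ^ N) (𝓝[<] (0 : ℝ))).mul (poly_bdd r)
    simpa using this
  have := IsBigO.add h h1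
  refine this.congr_left fun s => ?_
  simp

lemma Approx.mono {N M : ℕ} {f : ℝ → ℂ} {p : Polynomial ℂ} (h : Approx N f p) (hM : M ≤ N) :
    Approx M f p := by
  refine IsBigO.trans h ?_
  obtain ⟨k, rfl⟩ := Nat.exists_eq_add_of_le hM
  have := (isBigO_refl (fun s : ℝ => (s : ℂ) ^ M) (𝓝[<] (0 : ℝ))).mul (pow_bdd k)
  simpa [pow_add] using this

lemma Approx.congr_fun {N : ℕ} {f g : ℝ → ℂ} {p : Polynomial ℂ} (h : Approx N f p)
    (hfg : ∀ s < 0, f s = g s) : Approx N g p := by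
  refine IsBigO.congr' h ?_ EventuallyEq.rfl
  filter_upwards [self_mem_nhdsWithin] with s hs
  rw [hfg s hs]

lemma poly_limit (n : ℕ) (p : Polynomial ℂ) (L : ℂ)
    (h : Tendsto (fun s : ℝ => p.eval (s : ℂ) / (s : ℂ) ^ n) (𝓝[<] 0) (𝓝 L)) :
    p.coeff n = L := by
  have hcont : ∀ q : Polynomial ℂ, Tendsto (fun s : ℝ => q.eval (s : ℂ)) (𝓝[<] 0)
      (𝓝 (q.coeff 0)) := by
    intro q
    have h : Continuous (fun s : ℝ => q.eval (s : ℂ)) := by fun_prop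
    have := (h.tendsto 0).mono_left (nhdsWithin_le_nhds (s := Set.Iio 0))
    simpa [Polynomial.coeff_zero_eq_eval_zero] using this
  induction n generalizing p with
  | zero =>
    simp only [pow_zero, div_one] at h
    exact tendsto_nhds_unique (hcont p) h
  | succ n ih =>
    have h0 : p.coeff 0 = 0 := by
      have h1 : Tendsto (fun s : ℝ => (s : ℂ) ^ (n + 1)) (𝓝[<] 0) (𝓝 0) := by
        have h : Continuous (fun s : ℝ => (s : ℂ) ^ (n + 1)) := by fun_prop
        have := (h.tendsto 0).mono_left (nhdsWithin_le_nhds (s := Set.Iio 0))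
        simpa using this
      have h2 := h.mul h1
      rw [mul_zero] at h2
      refine tendsto_nhds_unique (hcont p) (h2.congr' ?_)
      filter_upwards [self_mem_nhdsWithin] with s hs
      have : (s : ℂ) ≠ 0 := by exact_mod_cast (ne_of_lt hs)
      field_simp
    have hp : p = Polynomial.X * p.divX := by
      conv_lhs => rw [← Polynomial.X_mul_divX_add p, h0]
      simp
    have := ih p.divX (h.congr' ?_)
    · rw [← this, Polynomial.coeff_divX]
    · filter_upwards [self_mem_nhdsWithin] with s hs
      have : (s : ℂ) ≠ 0 := by exact_mod_cast (ne_of_lt hs)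
      conv_lhs => rw [hp]
      rw [Polynomial.eval_mul, Polynomial.eval_X]
      field_simp
      ring

lemma Approx.limit {n : ℕ} {f : ℝ → ℂ} {p : Polynomial ℂ} {L : ℂ} (h : Approx (n + 1) f p)
    (hL : Tendsto (fun s : ℝ => f s / (s : ℂ) ^ n) (𝓝[<] 0) (𝓝 L)) : p.coeff n = L := by
  apply poly_limit
  have h1 : Tendsto (fun s : ℝ => (f s - p.eval (s : ℂ)) / (s : ℂ) ^ n) (𝓝[<] 0) (𝓝 0) := by
    have hs : Tendsto (fun s : ℝ => (s : ℂ)) (𝓝[<] 0) (𝓝 0) := by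
      have := (Complex.continuous_ofReal.tendsto 0).mono_left (nhdsWithin_le_nhds (s := Set.Iio 0))
      simpa using this
    refine IsBigO.trans_tendsto ?_ hs
    have := IsBigO.mul h (isBigO_refl (fun s : ℝ => ((s : ℂ) ^ n)⁻¹) (𝓝[<] (0 : ℝ)))
    refine IsBigO.congr' this (Eventually.of_forall fun s => by simp [div_eq_mul_inv]) ?_
    filter_upwards [self_mem_nhdsWithin] with s hs
    have : (s : ℂ) ≠ 0 := by exact_mod_cast (ne_of_lt hs)
    field_simp
    ring
  have := hL.sub h1
  rw [sub_zero] at this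
  refine this.congr fun s => ?_
  ring

lemma Approx.exp (N : ℕ) (b : ℂ) :
    Approx N (fun s => Complex.exp (s * b)) (tp N (fun k => b ^ k / (k.factorial : ℂ))) := by
  have h := Complex.exp_sub_sum_range_isBigO_pow N
  have ht : Tendsto (fun s : ℝ => (s : ℂ) * b) (𝓝[<] 0) (𝓝 0) := by
    have hc : Continuous (fun s : ℝ => (s : ℂ) * b) := by fun_prop
    have := (hc.tendsto 0).mono_left (nhdsWithin_le_nhds (s := Set.Iio 0))
    simpa using this
  have h2 := h.comp_tendsto ht
  have h3 : ((· ^ N) ∘ fun s : ℝ => (s : ℂ) * b) =O[𝓝[<] (0 : ℝ)] fun s : ℝ => (s : ℂ) ^ N := by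
    have : ((· ^ N) ∘ fun s : ℝ => (s : ℂ) * b) = fun s : ℝ => b ^ N * (s : ℂ) ^ N := by
      ext s; simp [mul_pow]; ring
    rw [this]
    exact isBigO_const_mul_self _ _ _
  refine (h2.trans h3).congr_left fun s => ?_
  simp only [Function.comp, tp, Polynomial.eval_finsetSum]
  congr 1
  refine Finset.sum_congr rfl fun k _ => ?_
  simp; ring

lemma den_ne (y s : ℝ) (hy : y ≠ 0) (hs : s < 0) (r : ℂ) (hr : ‖r‖ = 1) :
    1 - r * Complex.exp (-(s * y)) ≠ 0 := by
  intro h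
  have h1 := congrArg norm (sub_eq_zero.1 h)
  rw [norm_mul, hr, Complex.norm_exp] at h1
  have h2 : (-((s : ℂ) * y)).re = -(s * y) := by simp
  rw [h2, norm_one, one_mul, eq_comm, Real.exp_eq_one_iff, neg_eq_zero, mul_eq_zero] at h1
  exact h1.elim hs.ne hy

lemma todd_bdd (y : ℝ) (hy : y ≠ 0) (r : ℂ) :
    (fun s : ℝ => (s * y : ℂ) / (1 - r * Complex.exp (-(s * y)))) =O[𝓝[<] (0 : ℝ)]
      fun _ : ℝ => (1 : ℂ) := by
  by_cases hr : r = 1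
  · subst hr
    have hd : HasDerivAt (fun x : ℂ => 1 - 1 * Complex.exp (-x)) 1 0 := by
      have := ((hasDerivAt_neg (0 : ℂ)).cexp.const_mul 1).const_sub 1
      simpa using this
    have h1 := hd.tendsto_slope
    have ht : Tendsto (fun s : ℝ => (s : ℂ) * y) (𝓝[<] 0) (𝓝[≠] 0) := by
      refine tendsto_nhdsWithin_iff.2 ⟨?_, ?_⟩
      · have hc : Continuous (fun s : ℝ => (s : ℂ) * y) := by fun_prop
        have := (hc.tendsto 0).mono_left (nhdsWithin_le_nhds (s := Set.Iio 0))
        simpa using this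
      · filter_upwards [self_mem_nhdsWithin] with s hs
        have : (s : ℂ) ≠ 0 := by exact_mod_cast (ne_of_lt hs)
        simp [this, hy]
    have h2 := ((h1.comp ht).inv₀ one_ne_zero)
    refine (h2.isBigO_one ℂ).congr_left fun s => ?_
    simp [slope_def_field]
  · have hc : ContinuousAt (fun s : ℝ => (s * y : ℂ) / (1 - r * Complex.exp (-(s * y)))) 0 := by
      refine ContinuousAt.div (by fun_prop) (by fun_prop) ?_
      simpa [sub_eq_zero] using fun h => hr h.symm
    exact (hc.tendsto.mono_left nhdsWithin_le_nhds).isBigO_one ℂ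

lemma Approx.todd (n : ℕ) (td : ℂ → ℕ → ℂ) (htd : ToddCoeffs n td) (y : ℝ) (hy : y ≠ 0)
    (r : ℂ) (hr : ‖r‖ = 1) :
    Approx (n + 1) (fun s => (s * y : ℂ) / (1 - r * Complex.exp (-(s * y))))
      (tp (n + 1) (fun k => td r k * (y : ℂ) ^ k)) := by
  let P := tp (n + 2) (fun k => td r k * (y : ℂ) ^ k)
  have hPP : Approx (n + 1) (fun s => (s * y : ℂ) / (1 - r * Complex.exp (-(s * y)))) P := by
    have hE := (Approx.exp (n + 2) (-(y : ℂ))).const_mul (-r)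
    have hD := Approx.sum (N := n + 2) (Finset.univ : Finset Bool)
      (f := fun b s => if b then 1 else -r * Complex.exp (s * (-y)))
      (p := fun b => if b then 1 else
        Polynomial.C (-r) * tp (n + 2) (fun k => (-(y : ℂ)) ^ k / (k.factorial : ℂ)))
      (by rintro (_ | _) -
          · simpa using hE
          · simpa using Approx.poly (n + 2) 1)
    simp only [Fintype.sum_bool, if_true, Bool.false_eq_true, if_false] at hD
    have hM := (Approx.poly (n + 2) P).mul hD
    have hM2 := hM.congr_poly (q := Polynomial.C (y : ℂ) * Polynomial.X) (by
      intro m hm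
      have key := htd r m (by omega)
      rw [Polynomial.coeff_mul, Finset.Nat.sum_antidiagonal_eq_sum_range_succ_mk]
      rw [Polynomial.coeff_C_mul, Polynomial.coeff_X]
      have : (y : ℂ) * (if 1 = m then 1 else 0) = (y : ℂ) ^ m * (if m = 1 then 1 else 0) := by
        split_ifs with h1 h2 h2
        · rw [← h1]; ring
        · exact absurd h1.symm h2
        · exact absurd h2.symm h1
        · simp
      rw [this, ← key, Finset.mul_sum]
      refine Finset.sum_congr rfl fun k hk => ?_
      have hk' : k ≤ m := by simpa [Nat.lt_succ_iff] using hk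
      simp only [P]
      rw [tp_coeff, if_pos (by omega), Polynomial.coeff_add, Polynomial.coeff_C_mul, tp_coeff,
        if_pos (by omega), Polynomial.coeff_one]
      obtain ⟨j, rfl⟩ := Nat.exists_eq_add_of_le hk'
      rw [Nat.add_sub_cancel_left, neg_pow (y : ℂ) j, pow_add]
      by_cases hj : j = 0
      · subst hj; simp; ring
      · simp only [hj, if_false]; ring)
    have h3 := (hM2.neg_left).mul (todd_bdd y hy r)
    have h4 := h3.mul (isBigO_refl (fun s : ℝ => ((s : ℂ) * y)⁻¹) (𝓝[<] (0 : ℝ)))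
    have h5 : (fun s : ℝ => (s : ℂ) ^ (n + 2) * 1 * ((s : ℂ) * y)⁻¹) =O[𝓝[<] (0 : ℝ)]
        fun s : ℝ => (s : ℂ) ^ (n + 1) := by
      have : (fun s : ℝ => (s : ℂ) ^ (n + 2) * 1 * ((s : ℂ) * y)⁻¹) =ᶠ[𝓝[<] (0 : ℝ)]
          fun s : ℝ => (y : ℂ)⁻¹ * (s : ℂ) ^ (n + 1) := by
        filter_upwards [self_mem_nhdsWithin] with s hs
        have : (s : ℂ) ≠ 0 := by exact_mod_cast (ne_of_lt hs)
        have hy' : (y : ℂ) ≠ 0 := by exact_mod_cast hy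
        field_simp
        ring
      exact this.trans_isBigO (isBigO_const_mul_self _ _ _)
    refine (IsBigO.trans h4 h5).congr' ?_ EventuallyEq.rfl
    filter_upwards [self_mem_nhdsWithin] with s hs
    have h0 : (s : ℂ) ≠ 0 := by exact_mod_cast (ne_of_lt hs)
    have hy' : (y : ℂ) ≠ 0 := by exact_mod_cast hy
    have hd := den_ne y s hy hs r hr
    have e : (s : ℂ) * -(y : ℂ) = -(s * y) := by ring
    simp only [e, Polynomial.eval_mul, Polynomial.eval_C, Polynomial.eval_X]
    field_simp
    ring
  refine hPP.congr_poly fun m hm => ?_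
  simp only [P]
  rw [tp_coeff, tp_coeff, if_pos hm, if_pos (by omega)]
open Finset

section P5
variable {n d : ℕ}

lemma dotp_add_right (u x y : Fin n → ℝ) : dotp u (x + y) = dotp u x + dotp u y := by
  simp [dotp, mul_add, Finset.sum_add_distrib]

lemma dotp_smul_right (u x : Fin n → ℝ) (a : ℝ) : dotp u (a • x) = a * dotp u x := by
  simp only [dotp, Finset.mul_sum, Pi.smul_apply, smul_eq_mul]
  exact Finset.sum_congr rfl fun k _ => by ring

lemma dotp_neg_right (u x : Fin n → ℝ) : dotp u (-x) = - dotp u x := by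
  simp [dotp]

lemma dotp_sub_right (u x y : Fin n → ℝ) : dotp u (x - y) = dotp u x - dotp u y := by
  simp [dotp, mul_sub, Finset.sum_sub_distrib]

lemma dotp_sum_right {ι : Type*} (u : Fin n → ℝ) (t : Finset ι) (f : ι → Fin n → ℝ) :
    dotp u (∑ i ∈ t, f i) = ∑ i ∈ t, dotp u (f i) := by
  simp only [dotp, Finset.sum_apply, Finset.mul_sum]
  exact Finset.sum_comm

variable {Δ : LMultiFan n d} {uu : Finset (Fin d) → Fin d → (Fin n → ℝ)}

/-- An enumeration of a top simplex. -/
noncomputable def enumI {I : Finset (Fin d)} (hI : I.card = n) : Fin n ≃ {x // x ∈ I} :=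
  (I.equivFinOfCardEq hI).symm

lemma dualPair_of (huu : Δ.toMF.DualBasis uu) {I : Finset (Fin d)} (hS : I ∈ Δ.S)
    (hI : I.card = n) :
    DualPair (fun i => Δ.v (enumI hI i).1) (fun i => uu I (enumI hI i).1) := by
  intro i j
  have := huu I hS hI _ (enumI hI i).2 _ (enumI hI j).2
  refine this.trans ?_
  simp

lemma sum_enum {M : Type*} [AddCommMonoid M] {I : Finset (Fin d)} (hI : I.card = n)
    (f : Fin d → M) : ∑ i, f (enumI hI i).1 = ∑ i ∈ I, f i := by
  rw [(enumI hI).sum_comp (fun x => f x.1), Finset.sum_coe_sort I f]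

lemma prod_enum {M : Type*} [CommMonoid M] {I : Finset (Fin d)} (hI : I.card = n)
    (f : Fin d → M) : ∏ i, f (enumI hI i).1 = ∏ i ∈ I, f i := by
  rw [(enumI hI).prod_comp (fun x => f x.1), Finset.prod_coe_sort I f]

lemma expandI (huu : Δ.toMF.DualBasis uu) {I : Finset (Fin d)} (hS : I ∈ Δ.S)
    (hI : I.card = n) (x : Fin n → ℝ) :
    ∑ i ∈ I, dotp (uu I i) x • Δ.toMF.v i = x := by
  ext k
  have := (dualPair_of huu hS hI).expand x k
  rw [sum_enum hI (fun i => dotp (uu I i) x * (Δ.v i k : ℝ))] at this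
  simpa [LMultiFan.toMF] using this

lemma pairingI (huu : Δ.toMF.DualBasis uu) {I : Finset (Fin d)} (hS : I ∈ Δ.S)
    (hI : I.card = n) (u x : Fin n → ℝ) :
    dotp u x = ∑ i ∈ I, dotp (uu I i) x * dotp u (Δ.toMF.v i) := by
  conv_lhs => rw [← expandI huu hS hI x]
  rw [dotp_sum_right]
  simp only [dotp_smul_right]

lemma span_zero (huu : Δ.toMF.DualBasis uu) {I L : Finset (Fin d)} (hS : I ∈ Δ.S)
    (hI : I.card = n) (hL : L ⊆ I) {i : Fin d} (hi : i ∈ I) (hiL : i ∉ L) {x : Fin n → ℝ}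
    (hx : x ∈ Submodule.span ℝ (Δ.toMF.v '' (L : Set (Fin d)))) : dotp (uu I i) x = 0 := by
  induction hx using Submodule.span_induction with
  | mem x h =>
    obtain ⟨j, hj, rfl⟩ := h
    have hj' : j ∈ L := by simpa using hj
    rw [huu I hS hI i hi j (hL hj'), if_neg]
    rintro rfl; exact hiL hj'
  | zero => simp [dotp]
  | add x y _ _ hx hy => rw [dotp_add_right, hx, hy, add_zero]
  | smul a x _ hx => rw [dotp_smul_right, hx, mul_zero]

lemma inProj_iff (huu : Δ.toMF.DualBasis uu) {I K : Finset (Fin d)} (hS : I ∈ Δ.S)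
    (hI : I.card = n) (hK : K ⊆ I) (x : Fin n → ℝ) :
    Δ.toMF.InProjCone K I x ↔ ∀ i ∈ I \ K, 0 ≤ dotp (uu I i) x := by
  constructor
  · rintro ⟨a, ha, hx⟩ i hi
    have hi' := Finset.mem_sdiff.1 hi
    have := span_zero huu hS hI hK hi'.1 hi'.2 hx
    rw [dotp_sub_right, dotp_sum_right] at this
    have h2 : ∑ j ∈ I \ K, dotp (uu I i) (a j • Δ.toMF.v j) = a i := by
      rw [Finset.sum_eq_single i]
      · rw [dotp_smul_right, huu I hS hI i hi'.1 i hi'.1, if_pos rfl, mul_one]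
      · intro j hj hji
        rw [dotp_smul_right, huu I hS hI i hi'.1 j (Finset.mem_sdiff.1 hj).1, if_neg hji.symm,
          mul_zero]
      · intro h; exact absurd hi h
    have := ha i hi
    linarith
  · intro h
    refine ⟨fun i => dotp (uu I i) x, h, ?_⟩
    have e := expandI huu hS hI x
    rw [← Finset.sum_sdiff hK] at e
    have e2 : x - ∑ j ∈ I \ K, dotp (uu I j) x • Δ.toMF.v j
        = ∑ j ∈ K, dotp (uu I j) x • Δ.toMF.v j := by
      rw [sub_eq_iff_eq_add, add_comm]; exact e.symm
    rw [e2]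
    exact Submodule.sum_mem _ fun j hj => Submodule.smul_mem _ _
      (Submodule.subset_span ⟨j, by simpa using hj, rfl⟩)

lemma generic_of_dual (hC : Δ.toMF.Complete) (huu : Δ.toMF.DualBasis uu) {ξ : Fin n → ℝ}
    (hξ : Δ.toMF.GenericDual uu ξ) (K : Finset (Fin d)) : Δ.toMF.GenericFor K ξ := by
  intro L hL _ hcard hx
  obtain ⟨I, hS, hLI, hI⟩ := (hC L hL).1
  obtain ⟨i, hi, hiL⟩ := Finset.exists_mem_notMem_of_card_lt_card (hcard.trans_eq hI.symm)
  exact hξ I hS hI i hi (span_zero huu hS hI hLI hi hiL hx)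

lemma genericDual_neg {ξ : Fin n → ℝ} (hξ : Δ.toMF.GenericDual uu ξ) :
    Δ.toMF.GenericDual uu (-ξ) := by
  intro I hS hI i hi
  rw [dotp_neg_right]
  exact neg_ne_zero.2 (hξ I hS hI i hi)

lemma DH_eq {ξ : Fin n → ℝ} (hξ : Δ.toMF.GenericDual uu ξ) (c : Fin d → ℝ) (u : Fin n → ℝ) :
    (Δ.toMF.DH c uu ξ u : ℝ) = ∑ I ∈ Δ.S.filter (fun I => I.card = n),
      (Δ.w I : ℝ) * ∏ i ∈ I, sg (dotp (uu I i) ξ) (c i) (dotp u (Δ.toMF.v i)) := by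
  classical
  unfold MultiFan.DH
  push_cast
  refine Finset.sum_congr rfl fun I hI => ?_
  obtain ⟨hS, hI⟩ := Finset.mem_filter.1 hI
  split_ifs with h
  · rw [mul_comm]
    congr 1
    have : ∀ i ∈ I, sg (dotp (uu I i) ξ) (c i) (dotp u (Δ.toMF.v i))
        = if 0 < dotp (uu I i) ξ then (-1 : ℝ) else 1 := by
      intro i hi
      unfold sg
      rcases h i hi with ⟨h1, h2⟩ | ⟨h1, h2⟩
      · simp [h1, h2]
      · simp [h1.not_gt, h2]
    rw [Finset.prod_congr rfl this, Finset.prod_ite]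
    simp
  · push Not at h
    obtain ⟨i, hi, h1, h2⟩ := h
    symm
    apply mul_eq_zero_of_right
    apply Finset.prod_eq_zero hi
    unfold sg
    have h0 := hξ I hS hI i hi
    split_ifs with a b b
    · exact absurd (h1 a) (not_lt.2 b)
    · rfl
    · exact absurd (h2 (lt_of_le_of_ne (not_lt.1 a) h0)) (not_lt.2 b)
    · rfl

/-- `u` avoids all the hyperplanes. -/
def Off (Δ : LMultiFan n d) (c : Fin d → ℝ) (u : Fin n → ℝ) : Prop :=
  ∀ I ∈ Δ.S, I.card = n → ∀ i ∈ I, dotp u (Δ.toMF.v i) ≠ c i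

lemma prod_ind {ι : Type*} (s : Finset ι) (f : ι → ℝ) (P : ι → Prop) (Q : Prop) [Decidable Q]
    (h1 : ∀ i ∈ s, P i → f i = 1) (h2 : ∀ i ∈ s, ¬ P i → f i = 0) (hQ : Q ↔ ∀ i ∈ s, P i) :
    ∏ i ∈ s, f i = if Q then 1 else 0 := by
  split_ifs with h
  · exact Finset.prod_eq_one fun i hi => h1 i hi (hQ.1 h i hi)
  · rw [hQ] at h
    push Not at h
    obtain ⟨i, hi, h⟩ := h
    exact Finset.prod_eq_zero hi (h2 i hi h)

open scoped Classical in
lemma DH_eq_dv (huu : Δ.toMF.DualBasis uu) {ξ : Fin n → ℝ}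
    (hξ : Δ.toMF.GenericDual uu ξ) (c : Fin d → ℝ) (u : Fin n → ℝ) (hu : Off Δ c u) :
    (Δ.toMF.DH c uu ξ u : ℝ) = ∑ K ∈ Δ.S,
      (if ∀ i ∈ K, c i < dotp u (Δ.toMF.v i) then (-1 : ℝ) ^ K.card else 0)
        * (Δ.toMF.dv K (-ξ) : ℝ) := by
  rw [DH_eq hξ]
  have h1 : ∀ I ∈ Δ.S.filter (fun I => I.card = n),
      (Δ.w I : ℝ) * ∏ i ∈ I, sg (dotp (uu I i) ξ) (c i) (dotp u (Δ.toMF.v i))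
      = ∑ K ∈ Δ.S, (if ∀ i ∈ K, c i < dotp u (Δ.toMF.v i) then (-1 : ℝ) ^ K.card else 0) *
        (if K ⊆ I ∧ Δ.toMF.InProjCone K I (-ξ) then (Δ.w I : ℝ) else 0) := by
    intro I hI
    obtain ⟨hS, hI⟩ := Finset.mem_filter.1 hI
    rw [Finset.prod_congr rfl fun i hi => sg_eq _ _ _ (hu I hS hI i hi), Finset.prod_sub, Finset.mul_sum]
    have hsub : I.powerset ⊆ Δ.S := fun K hK => Δ.downClosed I hS K (Finset.mem_powerset.1 hK)
    rw [← Finset.sum_subset hsub]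
    · refine Finset.sum_congr rfl fun K hK => ?_
      have hK := Finset.mem_powerset.1 hK
      rw [inProj_iff huu hS hI hK]
      simp only [hK, true_and, dotp_neg_right, Left.nonneg_neg_iff]
      have e1 : ∏ i ∈ I \ K, (if 0 < dotp (uu I i) ξ then (0 : ℝ) else 1)
          = if ∀ i ∈ I \ K, dotp (uu I i) ξ ≤ 0 then 1 else 0 := by
        refine prod_ind _ _ (fun i => dotp (uu I i) ξ ≤ 0) _ ?_ ?_ Iff.rfl
        · intro i _ h; rw [if_neg (not_lt.2 h)]
        · intro i _ h; rw [if_pos (not_le.1 h)]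
      have e2 : ∏ i ∈ K, (if c i < dotp u (Δ.toMF.v i) then (1 : ℝ) else 0)
          = if ∀ i ∈ K, c i < dotp u (Δ.toMF.v i) then 1 else 0 := by
        refine prod_ind _ _ (fun i => c i < dotp u (Δ.toMF.v i)) _ ?_ ?_ Iff.rfl
        · intro i _ h; rw [if_pos h]
        · intro i _ h; rw [if_neg h]
      rw [e1, e2]
      split_ifs <;> ring
    · intro K _ hK
      apply mul_eq_zero_of_right
      rw [if_neg]
      rintro ⟨h, _⟩
      exact hK (Finset.mem_powerset.2 h)
  rw [Finset.sum_congr rfl h1, Finset.sum_comm]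
  refine Finset.sum_congr rfl fun K _ => ?_
  rw [← Finset.mul_sum]
  congr 1
  unfold MultiFan.dv
  push_cast
  rw [← Finset.sum_filter, Finset.filter_filter]
  rfl

lemma DH_indep (hC : Δ.toMF.Complete) (huu : Δ.toMF.DualBasis uu) {ξ η : Fin n → ℝ}
    (hξ : Δ.toMF.GenericDual uu ξ) (hη : Δ.toMF.GenericDual uu η) (c : Fin d → ℝ)
    (u : Fin n → ℝ) (hu : Off Δ c u) : Δ.toMF.DH c uu ξ u = Δ.toMF.DH c uu η u := by
  classical
  have : (Δ.toMF.DH c uu ξ u : ℝ) = Δ.toMF.DH c uu η u := by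
    rw [DH_eq_dv huu hξ c u hu, DH_eq_dv huu hη c u hu]
    refine Finset.sum_congr rfl fun K hK => ?_
    rw [(hC K hK).2 (-ξ) (-η) (generic_of_dual hC huu (genericDual_neg hξ) K)
      (generic_of_dual hC huu (genericDual_neg hη) K)]
  exact_mod_cast this

/-- The bound constant. -/
noncomputable def Bd (Δ : LMultiFan n d) (uu : Finset (Fin d) → Fin d → (Fin n → ℝ))
    (c : Fin d → ℝ) (η : Fin n → ℝ) : ℝ :=
  ∑ I ∈ Δ.S.filter (fun I => I.card = n), |∑ i ∈ I, dotp (uu I i) η * c i|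

lemma DH_lower (huu : Δ.toMF.DualBasis uu) {η : Fin n → ℝ} (c : Fin d → ℝ)
    (u : Fin n → ℝ) (h : Δ.toMF.DH c uu η u ≠ 0) : - Bd Δ uu c η ≤ dotp u η := by
  classical
  unfold MultiFan.DH at h
  obtain ⟨I, hI, h⟩ := Finset.exists_ne_zero_of_sum_ne_zero h
  have hI0 := hI
  obtain ⟨hS, hI⟩ := Finset.mem_filter.1 hI
  have h := (ite_ne_right_iff.1 h).1
  rw [pairingI huu hS hI u η]
  have h1 : ∑ i ∈ I, dotp (uu I i) η * c i ≤ ∑ i ∈ I, dotp (uu I i) η * dotp u (Δ.toMF.v i) := by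
    refine Finset.sum_le_sum fun i hi => ?_
    rcases h i hi with ⟨h1, h2⟩ | ⟨h1, h2⟩
    · exact mul_le_mul_of_nonneg_left h2 h1.le
    · exact mul_le_mul_of_nonpos_left h2 h1.le
  have h2 : |∑ i ∈ I, dotp (uu I i) η * c i| ≤ Bd Δ uu c η :=
    Finset.single_le_sum (f := fun I : Finset (Fin d) => |∑ i ∈ I, dotp (uu I i) η * c i|)
      (fun _ _ => abs_nonneg _) hI0
  have h3 := neg_abs_le (∑ i ∈ I, dotp (uu I i) η * c i)
  linarith

lemma Bd_neg (c : Fin d → ℝ) (η : Fin n → ℝ) : Bd Δ uu c (-η) = Bd Δ uu c η := by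
  unfold Bd
  simp only [dotp_neg_right, neg_mul, Finset.sum_neg_distrib, abs_neg]

lemma DH_abs (hC : Δ.toMF.Complete) (huu : Δ.toMF.DualBasis uu) {ξ η : Fin n → ℝ}
    (hξ : Δ.toMF.GenericDual uu ξ) (hη : Δ.toMF.GenericDual uu η) (c : Fin d → ℝ)
    (u : Fin n → ℝ) (hu : Off Δ c u) (h : Δ.toMF.DH c uu ξ u ≠ 0) :
    |dotp u η| ≤ Bd Δ uu c η := by
  have h1 := DH_lower huu c u (DH_indep hC huu hξ hη c u hu ▸ h)
  have h2 := DH_lower huu c u (DH_indep hC huu hξ (genericDual_neg hη) c u hu ▸ h)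
  rw [Bd_neg, dotp_neg_right] at h2
  rw [abs_le]; constructor <;> linarith

lemma exists_generic {ξ : Fin n → ℝ} (hξ : Δ.toMF.GenericDual uu ξ) (x : Fin n → ℝ) :
    ∃ δ : ℝ, Δ.toMF.GenericDual uu (x + δ • ξ) := by
  classical
  let bad : Finset ℝ := (Δ.S ×ˢ (Finset.univ : Finset (Fin d))).image
    (fun p => - dotp (uu p.1 p.2) x / dotp (uu p.1 p.2) ξ)
  obtain ⟨δ, hδ⟩ := Infinite.exists_notMem_finset bad
  refine ⟨δ, fun I hS hI i hi h0 => hδ ?_⟩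
  have hy := hξ I hS hI i hi
  refine Finset.mem_image.2 ⟨(I, i), Finset.mem_product.2 ⟨hS, Finset.mem_univ _⟩, ?_⟩
  rw [dotp_add_right, dotp_smul_right] at h0
  rw [div_eq_iff hy]
  linarith

lemma dotp_single (u : Fin n → ℝ) (k : Fin n) : dotp u (Pi.single k 1) = u k := by
  simp [dotp, Pi.single_apply]

lemma DH_support (hC : Δ.toMF.Complete) (huu : Δ.toMF.DualBasis uu) {ξ : Fin n → ℝ}
    (hξ : Δ.toMF.GenericDual uu ξ) (c : Fin d → ℝ) :
    ∃ R : ℝ, ∀ u, Off Δ c u → Δ.toMF.DH c uu ξ u ≠ 0 → ∀ k, |u k| ≤ R := by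
  choose δ hδ using fun k : Fin n => exists_generic hξ (Pi.single k (1 : ℝ))
  let R : Fin n → ℝ := fun k => Bd Δ uu c (Pi.single k (1 : ℝ) + δ k • ξ) + |δ k| * Bd Δ uu c ξ
  refine ⟨∑ k, |R k|, fun u hu h k => ?_⟩
  have h1 := DH_abs hC huu hξ (hδ k) c u hu h
  have h2 := DH_abs hC huu hξ hξ c u hu h
  rw [dotp_add_right, dotp_smul_right, dotp_single] at h1
  have h3 : |u k| ≤ R k := by
    have e : u k = (u k + δ k * dotp u ξ) - δ k * dotp u ξ := by ring
    rw [e]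
    refine (abs_sub _ _).trans ?_
    rw [abs_mul]
    exact add_le_add h1 (mul_le_mul_of_nonneg_left h2 (abs_nonneg _))
  refine (h3.trans (le_abs_self _)).trans ?_
  exact Finset.single_le_sum (f := fun k => |R k|) (fun _ _ => abs_nonneg _) (Finset.mem_univ k)

end P5
open Finset
open Filter Topology Asymptotics

section P6
variable {n d : ℕ} {Δ : LMultiFan n d} {uu : Finset (Fin d) → Fin d → (Fin n → ℝ)}

/-- Absolute determinant of a top simplex. -/
noncomputable def detI (Δ : LMultiFan n d) (I : Finset (Fin d)) : ℝ :=
  if h : I.card = n then |(VM (fun i => Δ.v (enumI h i).1)).det| else 1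

lemma detI_eq {I : Finset (Fin d)} (hI : I.card = n) :
    detI Δ I = |(VM (fun i => Δ.v (enumI hI i).1)).det| := by
  simp [detI, hI]

lemma detI_ne (huu : Δ.toMF.DualBasis uu) {I : Finset (Fin d)} (hS : I ∈ Δ.S)
    (hI : I.card = n) : detI Δ I ≠ 0 := by
  rw [detI_eq hI]
  simpa using (dualPair_of huu hS hI).det_ne

lemma measurable_dotp (x : Fin n → ℝ) : Measurable (fun u : Fin n → ℝ => dotp u x) := by
  unfold dotp; fun_prop

lemma DH_measurable {ξ : Fin n → ℝ} (hξ : Δ.toMF.GenericDual uu ξ) (c : Fin d → ℝ) :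
    Measurable (fun u => (Δ.toMF.DH c uu ξ u : ℝ)) := by
  simp only [DH_eq hξ]
  refine Finset.measurable_sum _ fun I _ => Measurable.const_mul ?_ _
  refine Finset.measurable_prod _ fun i _ => ?_
  exact (sg_measurable _ _).comp (measurable_dotp _)

lemma DH_bdd {ξ : Fin n → ℝ} (hξ : Δ.toMF.GenericDual uu ξ) (c : Fin d → ℝ) (u : Fin n → ℝ) :
    |(Δ.toMF.DH c uu ξ u : ℝ)| ≤ ∑ I ∈ Δ.S.filter (fun I => I.card = n), |(Δ.w I : ℝ)| := by
  rw [DH_eq hξ]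
  refine (Finset.abs_sum_le_sum_abs _ _).trans (Finset.sum_le_sum fun I _ => ?_)
  rw [abs_mul, Finset.abs_prod]
  refine mul_le_of_le_one_right (abs_nonneg _) ?_
  exact Finset.prod_le_one (fun _ _ => abs_nonneg _) fun _ _ => sg_abs_le _ _ _

lemma hyper_null (x : Fin n → ℝ) (hx : x ≠ 0) (a : ℝ) :
    MeasureTheory.volume {u : Fin n → ℝ | dotp u x = a} = 0 := by
  by_cases hne : ∃ p : Fin n → ℝ, dotp p x = a
  · obtain ⟨p, hp⟩ := hne
    let f : (Fin n → ℝ) →ₗ[ℝ] ℝ :=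
      { toFun := fun u => dotp u x
        map_add' := fun u v => by simp [dotp, add_mul, Finset.sum_add_distrib]
        map_smul' := fun r u => by simp [dotp, Finset.mul_sum, mul_assoc] }
    have hsub : {u : Fin n → ℝ | dotp u x = a} ⊆
        (AffineSubspace.mk' p (LinearMap.ker f) : Set (Fin n → ℝ)) := by
      intro u hu
      have hu : f u = a := hu
      have hp : f p = a := hp
      simp [AffineSubspace.mem_mk', hu, hp]
    refine MeasureTheory.measure_mono_null hsub
      (MeasureTheory.Measure.addHaar_affineSubspace _ _ ?_)
    intro htop
    have h1 := AffineSubspace.direction_mk' p (LinearMap.ker f)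
    rw [htop, AffineSubspace.direction_top] at h1
    apply hx
    ext k
    have : (Pi.single k 1 : Fin n → ℝ) ∈ LinearMap.ker f := h1 ▸ Submodule.mem_top
    have h2 : dotp (Pi.single k 1 : Fin n → ℝ) x = 0 := this
    simpa [dotp, Pi.single_apply] using h2
  · have : {u : Fin n → ℝ | dotp u x = a} = ∅ := by
      ext u; simp; exact fun h => hne ⟨u, h⟩
    simp [this]

lemma v_ne (huu : Δ.toMF.DualBasis uu) {I : Finset (Fin d)} (hS : I ∈ Δ.S)
    (hI : I.card = n) {i : Fin d} (hi : i ∈ I) : Δ.toMF.v i ≠ 0 := by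
  intro h
  have := huu I hS hI i hi i hi
  rw [h] at this
  simp [dotp] at this

lemma ae_off (huu : Δ.toMF.DualBasis uu) (c : Fin d → ℝ) :
    ∀ᵐ u : Fin n → ℝ, Off Δ c u := by
  unfold Off
  simp only [MeasureTheory.ae_all_iff]
  intro I hS hI i hi
  have := hyper_null (Δ.toMF.v i) (v_ne huu hS hI hi) (c i)
  rw [MeasureTheory.ae_iff]
  simpa using this

lemma vol_tendsto (hC : Δ.toMF.Complete) (huu : Δ.toMF.DualBasis uu) {ξ : Fin n → ℝ}
    (hξ : Δ.toMF.GenericDual uu ξ) (c : Fin d → ℝ) :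
    Tendsto (fun s : ℝ => ∫ u : Fin n → ℝ, (Δ.toMF.DH c uu ξ u : ℝ) * Real.exp (s * dotp u ξ))
      (𝓝[<] 0) (𝓝 (∫ u : Fin n → ℝ, (Δ.toMF.DH c uu ξ u : ℝ))) := by
  obtain ⟨R, hR⟩ := DH_support hC huu hξ c
  set M := ∑ I ∈ Δ.S.filter (fun I => I.card = n), |(Δ.w I : ℝ)|
  let box : Set (Fin n → ℝ) := Set.Icc (fun _ => -R) (fun _ => R)
  refine MeasureTheory.tendsto_integral_filter_of_dominated_convergence
    (box.indicator fun _ => M * Real.exp (Bd Δ uu c ξ)) ?_ ?_ ?_ ?_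
  · refine Eventually.of_forall fun s => Measurable.aestronglyMeasurable ?_
    have h1 := DH_measurable hξ c
    have h2 := measurable_dotp ξ
    fun_prop
  · have : Set.Ioo (-1 : ℝ) 0 ∈ 𝓝[<] (0 : ℝ) := Ioo_mem_nhdsLT (by norm_num)
    filter_upwards [this] with s hs
    filter_upwards [ae_off huu c] with u hu
    by_cases h : Δ.toMF.DH c uu ξ u = 0
    · simp only [h, Int.cast_zero, zero_mul, norm_zero]
      refine Set.indicator_nonneg (fun _ _ => ?_) _
      exact mul_nonneg (Finset.sum_nonneg fun _ _ => abs_nonneg _) (Real.exp_pos _).le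
    · have hb : u ∈ box := by
        constructor <;> intro k <;> have := abs_le.1 (hR u hu h k)
        · exact this.1
        · exact this.2
      rw [Set.indicator_of_mem hb, norm_mul, Real.norm_eq_abs, Real.norm_eq_abs, Real.abs_exp]
      refine mul_le_mul (DH_bdd hξ c u) (Real.exp_le_exp.2 ?_) (Real.exp_pos _).le
        (Finset.sum_nonneg fun _ _ => abs_nonneg _)
      have h1 := DH_abs hC huu hξ hξ c u hu h
      calc s * dotp u ξ ≤ |s * dotp u ξ| := le_abs_self _
        _ = |s| * |dotp u ξ| := abs_mul _ _
        _ ≤ 1 * |dotp u ξ| := by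
            refine mul_le_mul_of_nonneg_right ?_ (abs_nonneg _)
            rw [abs_le]; constructor <;> linarith [hs.1, hs.2]
        _ ≤ _ := by rw [one_mul]; exact h1
  · rw [MeasureTheory.integrable_indicator_iff measurableSet_Icc]
    exact MeasureTheory.integrableOn_const (isCompact_Icc.measure_lt_top.ne)
  · refine Eventually.of_forall fun u => ?_
    have hc : Continuous (fun s : ℝ => (Δ.toMF.DH c uu ξ u : ℝ) * Real.exp (s * dotp u ξ)) := by
      fun_prop
    have := (hc.tendsto 0).mono_left (nhdsWithin_le_nhds (s := Set.Iio 0))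
    simpa using this

lemma local_integralI (huu : Δ.toMF.DualBasis uu) {ξ : Fin n → ℝ}
    (hξ : Δ.toMF.GenericDual uu ξ) (c : Fin d → ℝ) {I : Finset (Fin d)} (hS : I ∈ Δ.S)
    (hI : I.card = n) (s : ℝ) (hs : s < 0) :
    MeasureTheory.Integrable (fun u : Fin n → ℝ =>
      (∏ i ∈ I, sg (dotp (uu I i) ξ) (c i) (dotp u (Δ.toMF.v i))) * Real.exp (s * dotp u ξ)) ∧
    ∫ u : Fin n → ℝ,
      (∏ i ∈ I, sg (dotp (uu I i) ξ) (c i) (dotp u (Δ.toMF.v i))) * Real.exp (s * dotp u ξ) =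
    (detI Δ I)⁻¹ * (Real.exp (s * ∑ i ∈ I, c i * dotp (uu I i) ξ) *
      ∏ i ∈ I, (1 / (s * dotp (uu I i) ξ))) := by
  have := local_integral (dualPair_of huu hS hI) ξ (fun i => c (enumI hI i).1)
    (fun i => hξ I hS hI _ (enumI hI i).2) s hs
  have e1 : ∀ u : Fin n → ℝ, ∏ i, sg (dotp (uu I (enumI hI i).1) ξ) (c (enumI hI i).1)
      (dotp u (fun k => (Δ.v (enumI hI i).1 k : ℝ)))
      = ∏ i ∈ I, sg (dotp (uu I i) ξ) (c i) (dotp u (Δ.toMF.v i)) := fun u =>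
    prod_enum hI (fun i => sg (dotp (uu I i) ξ) (c i) (dotp u (Δ.toMF.v i)))
  simp only [e1] at this
  rw [sum_enum hI (fun i => c i * dotp (uu I i) ξ),
    prod_enum hI (fun i => 1 / (s * dotp (uu I i) ξ)), ← detI_eq hI] at this
  exact this

lemma vol_exp (huu : Δ.toMF.DualBasis uu) {ξ : Fin n → ℝ}
    (hξ : Δ.toMF.GenericDual uu ξ) (c : Fin d → ℝ) (s : ℝ) (hs : s < 0) :
    ∫ u : Fin n → ℝ, (Δ.toMF.DH c uu ξ u : ℝ) * Real.exp (s * dotp u ξ)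
    = ∑ I ∈ Δ.S.filter (fun I => I.card = n), (Δ.w I : ℝ) *
      ((detI Δ I)⁻¹ * (Real.exp (s * ∑ i ∈ I, c i * dotp (uu I i) ξ) *
      ∏ i ∈ I, (1 / (s * dotp (uu I i) ξ)))) := by
  simp only [DH_eq hξ, Finset.sum_mul, mul_assoc]
  rw [MeasureTheory.integral_finsetSum]
  · refine Finset.sum_congr rfl fun I hI => ?_
    obtain ⟨hS, hI⟩ := Finset.mem_filter.1 hI
    rw [MeasureTheory.integral_const_mul, (local_integralI huu hξ c hS hI s hs).2]
  · intro I hI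
    obtain ⟨hS, hI⟩ := Finset.mem_filter.1 hI
    exact (local_integralI huu hξ c hS hI s hs).1.const_mul _

/-- The coefficient attached to a top simplex. -/
noncomputable def cf (Δ : LMultiFan n d) (uu : Finset (Fin d) → Fin d → (Fin n → ℝ))
    (ξ : Fin n → ℝ) (I : Finset (Fin d)) : ℂ :=
  (Δ.w I : ℂ) * (((detI Δ I : ℝ) : ℂ)⁻¹ * ∏ i ∈ I, ((dotp (uu I i) ξ : ℝ) : ℂ)⁻¹)

lemma vol_formula (hC : Δ.toMF.Complete) (huu : Δ.toMF.DualBasis uu) {ξ : Fin n → ℝ}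
    (hξ : Δ.toMF.GenericDual uu ξ) (c : Fin d → ℝ) :
    (((∫ u : Fin n → ℝ, (Δ.toMF.DH c uu ξ u : ℝ)) : ℝ) : ℂ)
    = ∑ I ∈ Δ.S.filter (fun I => I.card = n), cf Δ uu ξ I *
      (((∑ i ∈ I, c i * dotp (uu I i) ξ : ℝ) : ℂ) ^ n / (n.factorial : ℂ)) := by
  have hA : Approx (n + 1) (fun s => ∑ I ∈ Δ.S.filter (fun I => I.card = n), cf Δ uu ξ I *
      Complex.exp (s * ((∑ i ∈ I, c i * dotp (uu I i) ξ : ℝ) : ℂ))) _ :=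
    Approx.sum _ fun I _ => (Approx.exp (n + 1) _).const_mul (cf Δ uu ξ I)
  have ht := (Complex.continuous_ofReal.tendsto _).comp (vol_tendsto hC huu hξ c)
  have := hA.limit (ht.congr' ?_)
  · rw [← this]
    simp only [Polynomial.finsetSum_coeff, Polynomial.coeff_C_mul, tp_coeff]
    simp
  · filter_upwards [self_mem_nhdsWithin] with s hs
    have hs : s < 0 := hs
    have h0 : (s : ℂ) ≠ 0 := by exact_mod_cast (ne_of_lt hs)
    simp only [Function.comp]
    rw [vol_exp huu hξ c s hs, Finset.sum_div]
    push_cast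
    refine Finset.sum_congr rfl fun I hI => ?_
    obtain ⟨hS, hI⟩ := Finset.mem_filter.1 hI
    unfold cf
    have e : ∏ i ∈ I, (1 / ((s : ℂ) * ((dotp (uu I i) ξ : ℝ) : ℂ)))
        = ((s : ℂ) ^ n)⁻¹ * ∏ i ∈ I, ((dotp (uu I i) ξ : ℝ) : ℂ)⁻¹ := by
      simp only [one_div, mul_inv, Finset.prod_mul_distrib, Finset.prod_const, hI, inv_pow]
    rw [e]
    ring

end P6
open Finset
open Filter Topology Asymptotics

section P7
variable {n d : ℕ} {Δ : LMultiFan n d} {uu : Finset (Fin d) → Fin d → (Fin n → ℝ)}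

/-- The group `G_I` inside `[0,1)^d`. -/
def GDI (Δ : LMultiFan n d) (I : Finset (Fin d)) : Set (Fin d → ℝ) :=
  {a | (∀ i, 0 ≤ a i ∧ a i < 1) ∧ (∀ j, j ∉ I → a j = 0) ∧
         ∀ k : Fin n, ∃ m : ℤ, (∑ i ∈ I, a i * (Δ.v i k : ℝ)) = (m : ℝ)}

lemma GDI_bijOn {I : Finset (Fin d)} (hI : I.card = n) :
    Set.BijOn (fun (a : Fin d → ℝ) (i : Fin n) => a (enumI hI i).1) (GDI Δ I)
      (GLoc (fun i => Δ.v (enumI hI i).1)) := by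
  refine ⟨?_, ?_, ?_⟩
  · rintro a ⟨h1, h2, h3⟩
    refine ⟨fun i => h1 _, fun k => ?_⟩
    obtain ⟨m, hm⟩ := h3 k
    exact ⟨m, (sum_enum hI (fun i => a i * (Δ.v i k : ℝ))).trans hm⟩
  · rintro a ⟨h1, h2, h3⟩ b ⟨h1', h2', h3'⟩ hab
    ext j
    by_cases hj : j ∈ I
    · have := congrFun hab ((enumI hI).symm ⟨j, hj⟩)
      simpa using this
    · rw [h2 j hj, h2' j hj]
  · rintro a ⟨h1, h3⟩
    let b : Fin d → ℝ := fun j => if h : j ∈ I then a ((enumI hI).symm ⟨j, h⟩) else 0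
    have hb : (fun (i : Fin n) => b (enumI hI i).1) = a := by
      ext i
      simp [b]
    refine ⟨b, ⟨fun i => ?_, fun j hj => by simp [b, hj], fun k => ?_⟩, hb⟩
    · simp only [b]
      split_ifs
      · exact h1 _
      · simp
    · obtain ⟨m, hm⟩ := h3 k
      refine ⟨m, ?_⟩
      rw [← hm, ← sum_enum hI (fun i => b i * (Δ.v i k : ℝ))]
      refine Finset.sum_congr rfl fun i _ => ?_
      rw [← congrFun hb i]

lemma GDI_finite (huu : Δ.toMF.DualBasis uu) {I : Finset (Fin d)} (hS : I ∈ Δ.S)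
    (hI : I.card = n) : (GDI Δ I).Finite :=
  Set.Finite.of_finite_image ((GLoc_finite (dualPair_of huu hS hI)).subset
    (GDI_bijOn hI).image_eq.subset) (GDI_bijOn hI).injOn

lemma sum_GLoc (huu : Δ.toMF.DualBasis uu) {I : Finset (Fin d)} (hS : I ∈ Δ.S)
    (hI : I.card = n) (F : Fin d → ℝ → ℂ) :
    ∑ a ∈ (GLoc_finite (dualPair_of huu hS hI)).toFinset, ∏ i, F (enumI hI i).1 (a i)
    = ∑ a ∈ (GDI_finite huu hS hI).toFinset, ∏ i ∈ I, F i (a i) := by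
  symm
  refine Finset.sum_nbij (fun (a : Fin d → ℝ) (i : Fin n) => a (enumI hI i).1) ?_ ?_ ?_ ?_
  · intro a ha
    exact (Set.Finite.mem_toFinset _).2 ((GDI_bijOn hI).mapsTo ((Set.Finite.mem_toFinset _).1 ha))
  · simpa using (GDI_bijOn hI).injOn
  · simpa using (GDI_bijOn hI).surjOn
  · intro a ha
    exact (prod_enum hI (fun i => F i (a i))).symm

open scoped Classical in
/-- Finite set of elements of `G_I` (for `I` a top simplex). -/
noncomputable def GDF (Δ : LMultiFan n d) (I : Finset (Fin d)) : Finset (Fin d → ℝ) :=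
  if h : (GDI Δ I).Finite then h.toFinset else ∅

lemma GDF_eq (huu : Δ.toMF.DualBasis uu) {I : Finset (Fin d)} (hS : I ∈ Δ.S)
    (hI : I.card = n) : GDF Δ I = (GDI_finite huu hS hI).toFinset := by
  rw [GDF, dif_pos (GDI_finite huu hS hI)]

lemma local_sumI (huu : Δ.toMF.DualBasis uu) {ξ : Fin n → ℝ}
    (hξ : Δ.toMF.GenericDual uu ξ) (c : Fin d → ℝ) (hlat : Δ.LatticeVertices c uu)
    {I : Finset (Fin d)} (hS : I ∈ Δ.S) (hI : I.card = n) (s : ℝ) (hs : s < 0) :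
    HasSum (fun u : Fin n → ℤ =>
      (((∏ i ∈ I, sg (dotp (uu I i) ξ) (c i + 1/2) (dotp (fun k => (u k : ℝ)) (Δ.toMF.v i))) *
        Real.exp (s * dotp (fun k => (u k : ℝ)) ξ) : ℝ) : ℂ))
      ((((detI Δ I : ℝ) : ℂ))⁻¹ * (Complex.exp (s * ((∑ i ∈ I, c i * dotp (uu I i) ξ : ℝ) : ℂ)) *
        ∑ a ∈ GDF Δ I,
          ∏ i ∈ I, (1 / (1 - e1 (a i) * Complex.exp (-(s * dotp (uu I i) ξ)))))) := by
  have := local_sum (dualPair_of huu hS hI) ξ (fun i => c (enumI hI i).1)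
    (fun i => hξ I hS hI _ (enumI hI i).2) (fun k => by
      obtain ⟨m, hm⟩ := hlat I hS hI k
      exact ⟨m, (sum_enum hI (fun i => c i * uu I i k)).trans hm⟩) s hs
  have e1' : ∀ u : Fin n → ℝ, ∏ i, sg (dotp (uu I (enumI hI i).1) ξ) (c (enumI hI i).1 + 1/2)
      (dotp u (fun k => (Δ.v (enumI hI i).1 k : ℝ)))
      = ∏ i ∈ I, sg (dotp (uu I i) ξ) (c i + 1/2) (dotp u (Δ.toMF.v i)) := fun u =>
    prod_enum hI (fun i => sg (dotp (uu I i) ξ) (c i + 1/2) (dotp u (Δ.toMF.v i)))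
  simp only [e1'] at this
  rw [sum_enum hI (fun i => c i * dotp (uu I i) ξ), ← detI_eq hI,
    sum_GLoc huu hS hI (fun i x => 1 / (1 - e1 x * Complex.exp (-(s * dotp (uu I i) ξ)))),
    ← GDF_eq huu hS hI] at this
  exact this

lemma c_int (huu : Δ.toMF.DualBasis uu) (c : Fin d → ℝ) (hlat : Δ.LatticeVertices c uu)
    {I : Finset (Fin d)} (hS : I ∈ Δ.S) (hI : I.card = n) {i : Fin d} (hi : i ∈ I) :
    ∃ m : ℤ, c i = m := by
  choose u0 hu0 using hlat I hS hI
  refine ⟨∑ k, u0 k * Δ.v i k, ?_⟩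
  have h1 : ∑ j ∈ I, c j * dotp (uu I j) (Δ.toMF.v i) = c i := by
    rw [Finset.sum_eq_single i]
    · rw [huu I hS hI i hi i hi, if_pos rfl, mul_one]
    · intro j hj hji
      rw [huu I hS hI j hj i hi, if_neg hji, mul_zero]
    · intro h; exact absurd hi h
  rw [← h1]
  push_cast
  simp only [← hu0, dotp, Finset.mul_sum, Finset.sum_mul]
  rw [Finset.sum_comm]
  refine Finset.sum_congr rfl fun k _ => Finset.sum_congr rfl fun j _ => ?_
  simp only [LMultiFan.toMF]; ring

lemma off_lattice (huu : Δ.toMF.DualBasis uu) (c : Fin d → ℝ) (hlat : Δ.LatticeVertices c uu)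
    (u : Fin n → ℤ) : Off Δ (fun i => c i + 1/2) (fun k => (u k : ℝ)) := by
  intro I hS hI i hi h
  obtain ⟨m, hm⟩ := c_int huu c hlat hS hI hi
  have h1 : dotp (fun k => (u k : ℝ)) (Δ.toMF.v i) = ((∑ k, u k * Δ.v i k : ℤ) : ℝ) := by
    simp [dotp, LMultiFan.toMF]
  simp only [h1, hm] at h
  have h2 : ((2 * (∑ k, u k * Δ.v i k) : ℤ) : ℝ) = ((2 * m + 1 : ℤ) : ℝ) := by
    rw [Int.cast_mul, h]; push_cast; ring
  have h3 : 2 * (∑ k, u k * Δ.v i k) = 2 * m + 1 := by exact_mod_cast h2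
  omega

lemma count_support (hC : Δ.toMF.Complete) (huu : Δ.toMF.DualBasis uu) {ξ : Fin n → ℝ}
    (hξ : Δ.toMF.GenericDual uu ξ) (c : Fin d → ℝ) (hlat : Δ.LatticeVertices c uu) :
    ∃ T : Finset (Fin n → ℤ), ∀ u, u ∉ T →
      Δ.toMF.DH (fun i => c i + 1/2) uu ξ (fun k => (u k : ℝ)) = 0 := by
  obtain ⟨R, hR⟩ := DH_support hC huu hξ (fun i => c i + 1/2)
  refine ⟨Finset.Icc (fun _ => -⌈R⌉) (fun _ => ⌈R⌉), fun u hu => ?_⟩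
  by_contra h
  apply hu
  have := hR _ (off_lattice huu c hlat u) h
  rw [Finset.mem_Icc]
  constructor <;> intro k <;> have h1 := abs_le.1 (this k) <;> have h2 := Int.le_ceil R
  · have : ((-⌈R⌉ : ℤ) : ℝ) ≤ u k := by push_cast; linarith [h1.1]
    exact_mod_cast this
  · have : (u k : ℝ) ≤ (⌈R⌉ : ℤ) := by linarith [h1.2]
    exact_mod_cast this

lemma count_formula (hC : Δ.toMF.Complete) (huu : Δ.toMF.DualBasis uu) {ξ : Fin n → ℝ}
    (hξ : Δ.toMF.GenericDual uu ξ) (c : Fin d → ℝ) (hlat : Δ.LatticeVertices c uu)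
    (td : ℂ → ℕ → ℂ) (htd : ToddCoeffs n td) :
    (Δ.sharpP c uu ξ : ℂ)
    = ∑ I ∈ Δ.S.filter (fun I => I.card = n), cf Δ uu ξ I * ∑ a ∈ GDF Δ I,
      (tp (n + 1) (fun k => ((∑ i ∈ I, c i * dotp (uu I i) ξ : ℝ) : ℂ) ^ k / (k.factorial : ℂ)) *
        ∏ i ∈ I, tp (n + 1) (fun k => td (e1 (a i)) k *
          ((dotp (uu I i) ξ : ℝ) : ℂ) ^ k)).coeff n := by
  have hA : Approx (n + 1) (fun s => ∑ I ∈ Δ.S.filter (fun I => I.card = n), cf Δ uu ξ I *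
      ∑ a ∈ GDF Δ I, (Complex.exp (s * ((∑ i ∈ I, c i * dotp (uu I i) ξ : ℝ) : ℂ)) *
        ∏ i ∈ I, (((s : ℂ) * ((dotp (uu I i) ξ : ℝ) : ℂ)) /
          (1 - e1 (a i) * Complex.exp (-(s * ((dotp (uu I i) ξ : ℝ) : ℂ))))))) _ :=
    Approx.sum _ fun I hI => (Approx.sum _ fun a _ =>
      (Approx.exp (n + 1) _).mul (Approx.prod I fun i hi => Approx.todd n td htd _
        (hξ I (Finset.mem_filter.1 hI).1 (Finset.mem_filter.1 hI).2 i hi) (e1 (a i))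
          (e1_norm _))).const_mul (cf Δ uu ξ I)
  obtain ⟨T, hT⟩ := count_support hC huu hξ c hlat
  let Cs : ℝ → ℂ := fun s => ∑ u ∈ T,
    ((((Δ.toMF.DH (fun i => c i + 1/2) uu ξ (fun k => (u k : ℝ)) : ℤ) : ℝ) *
      Real.exp (s * dotp (fun k => (u k : ℝ)) ξ) : ℝ) : ℂ)
  have hsharp : (Δ.sharpP c uu ξ : ℂ) = Cs 0 := by
    unfold LMultiFan.sharpP
    rw [finsum_eq_sum_of_support_subset (s := T)]
    · simp [Cs]
    · intro u hu
      by_contra h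
      exact hu (hT u (by simpa using h))
  have ht : Tendsto Cs (𝓝[<] 0) (𝓝 (Δ.sharpP c uu ξ : ℂ)) := by
    rw [hsharp]
    have : Continuous Cs := by
      refine continuous_finsetSum _ fun u _ => ?_
      fun_prop
    exact (this.tendsto 0).mono_left nhdsWithin_le_nhds
  have hCs : ∀ s < 0, Cs s = ∑ I ∈ Δ.S.filter (fun I => I.card = n), (Δ.w I : ℂ) *
      ((((detI Δ I : ℝ) : ℂ))⁻¹ *
        (Complex.exp (s * ((∑ i ∈ I, c i * dotp (uu I i) ξ : ℝ) : ℂ)) *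
        ∑ a ∈ GDF Δ I,
          ∏ i ∈ I, (1 / (1 - e1 (a i) * Complex.exp (-(s * dotp (uu I i) ξ)))))) := by
    intro s hs
    have h1 : HasSum (fun u : Fin n → ℤ =>
        ((((Δ.toMF.DH (fun i => c i + 1/2) uu ξ (fun k => (u k : ℝ)) : ℤ) : ℝ) *
        Real.exp (s * dotp (fun k => (u k : ℝ)) ξ) : ℝ) : ℂ)) (Cs s) := by
      refine hasSum_sum_of_ne_finset_zero fun u hu => ?_
      rw [hT u hu]; simp
    have h2 := hasSum_sum (s := (Δ.S.filter (fun I => I.card = n))) (fun I hI =>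
      (local_sumI huu hξ c hlat (Finset.mem_filter.1 hI).1 (Finset.mem_filter.1 hI).2
        s hs).mul_left (Δ.w I : ℂ))
    refine h1.unique ?_
    refine hasSum_of_eq h2 ?_ rfl
    intro u
    rw [DH_eq hξ]
    push_cast
    rw [Finset.sum_mul]
    exact Finset.sum_congr rfl fun I _ => by ring
  have := hA.limit (ht.congr' ?_)
  · rw [← this]
    simp only [Polynomial.finsetSum_coeff, Polynomial.coeff_C_mul]
  · filter_upwards [self_mem_nhdsWithin] with s hs
    have hs : s < 0 := hs
    have h0 : (s : ℂ) ≠ 0 := by exact_mod_cast (ne_of_lt hs)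
    rw [hCs s hs, Finset.sum_div]
    refine Finset.sum_congr rfl fun I hI => ?_
    obtain ⟨hS, hI⟩ := Finset.mem_filter.1 hI
    unfold cf
    rw [Finset.mul_sum, Finset.mul_sum, Finset.mul_sum, Finset.mul_sum, Finset.sum_div]
    refine Finset.sum_congr rfl fun a _ => ?_
    have e : ∏ i ∈ I, (((s : ℂ) * ((dotp (uu I i) ξ : ℝ) : ℂ)) /
          (1 - e1 (a i) * Complex.exp (-(s * ((dotp (uu I i) ξ : ℝ) : ℂ)))))
        = (s : ℂ) ^ n * (∏ i ∈ I, ((dotp (uu I i) ξ : ℝ) : ℂ)) * ∏ i ∈ I, (1 /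
          (1 - e1 (a i) * Complex.exp (-(s * ((dotp (uu I i) ξ : ℝ) : ℂ))))) := by
      have e0 : (s : ℂ) ^ n = ∏ i ∈ I, (s : ℂ) := by rw [Finset.prod_const, hI]
      rw [e0, ← Finset.prod_mul_distrib, ← Finset.prod_mul_distrib]
      exact Finset.prod_congr rfl fun i _ => by ring
    have hp : ∏ i ∈ I, ((dotp (uu I i) ξ : ℝ) : ℂ) ≠ 0 :=
      Finset.prod_ne_zero_iff.2 fun i hi => by exact_mod_cast hξ I hS hI i hi
    rw [e, Finset.prod_inv_distrib]
    generalize ∏ i ∈ I, (1 /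
          (1 - e1 (a i) * Complex.exp (-(s * ((dotp (uu I i) ξ : ℝ) : ℂ))))) = Z
    field_simp

end P7
open Finset
open Filter Topology Asymptotics

section P8
variable {n d : ℕ}

/-- The linear functional on polynomials taking `X^m` to `τ m`. -/
noncomputable def Phi (τ : (Fin d →₀ ℕ) → ℂ) : MvPolynomial (Fin d) ℂ →ₗ[ℂ] ℂ :=
  (MvPolynomial.basisMonomials (Fin d) ℂ).constr ℂ τ

lemma Phi_monomial (τ : (Fin d →₀ ℕ) → ℂ) (m : Fin d →₀ ℕ) (a : ℂ) :
    Phi τ (MvPolynomial.monomial m a) = a * τ m := by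
  have h1 : MvPolynomial.monomial m a = a • MvPolynomial.monomial m (1 : ℂ) := by
    rw [MvPolynomial.smul_monomial, smul_eq_mul, mul_one]
  rw [h1, map_smul, smul_eq_mul]
  congr 1
  have := (MvPolynomial.basisMonomials (Fin d) ℂ).constr_basis ℂ τ m
  rwa [MvPolynomial.coe_basisMonomials] at this

lemma Phi_apply (τ : (Fin d →₀ ℕ) → ℂ) (W : MvPolynomial (Fin d) ℂ) :
    Phi τ W = ∑ m ∈ W.support, τ m * MvPolynomial.coeff m W := by
  conv_lhs => rw [W.as_sum]
  rw [map_sum]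
  exact Finset.sum_congr rfl fun m _ => by rw [Phi_monomial, mul_comm]

lemma prod_tp_coeff {ι : Type*} [Fintype ι] [DecidableEq ι] (n : ℕ) (α : ι → ℕ → ℂ) :
    (∏ j, tp (n + 1) (α j)).coeff n = ∑ κ ∈ Finset.piAntidiag (Finset.univ : Finset ι) n,
      ∏ j, α j (κ j) := by
  unfold tp
  rw [Finset.prod_univ_sum, Polynomial.finsetSum_coeff]
  have h : ∀ κ : ι → ℕ, (∏ j, Polynomial.C (α j (κ j)) * Polynomial.X ^ (κ j)).coeff n
      = if n = ∑ j, κ j then ∏ j, α j (κ j) else 0 := by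
    intro κ
    rw [Finset.prod_mul_distrib, Finset.prod_pow_eq_pow_sum, ← map_prod,
      Polynomial.coeff_C_mul, Polynomial.coeff_X_pow]
    simp
  simp only [h]
  rw [← Finset.sum_filter]
  refine Finset.sum_congr ?_ fun _ _ => rfl
  ext κ
  simp only [Finset.mem_filter, Fintype.mem_piFinset, Finset.mem_range, Finset.mem_piAntidiag]
  constructor
  · rintro ⟨_, h⟩
    exact ⟨h.symm, fun i _ => Finset.mem_univ i⟩
  · rintro ⟨h, _⟩
    refine ⟨fun j => ?_, h.symm⟩
    have := Finset.single_le_sum (f := κ) (fun _ _ => Nat.zero_le _) (Finset.mem_univ j)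
    exact Nat.lt_succ_of_le (this.trans (le_of_eq h))

lemma Phi_pow (n : ℕ) (t : Fin d → ℕ → ℂ) (b : ℂ) (y : Fin d → ℂ) :
    Phi (fun m => (∏ i, t i (m i)) * ∏ i, ((m i).factorial : ℂ))
      (MvPolynomial.C ((n.factorial : ℂ)⁻¹) *
        (MvPolynomial.C b + ∑ i, MvPolynomial.C (y i) * MvPolynomial.X i) ^ n)
    = (tp (n + 1) (fun k => b ^ k / (k.factorial : ℂ)) *
        ∏ i, tp (n + 1) (fun k => t i k * y i ^ k)).coeff n := by
  let z : Option (Fin d) → MvPolynomial (Fin d) ℂ := fun j =>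
    j.elim (MvPolynomial.C b) (fun i => MvPolynomial.C (y i) * MvPolynomial.X i)
  have hz : MvPolynomial.C b + ∑ i, MvPolynomial.C (y i) * MvPolynomial.X i = ∑ j, z j := by
    rw [Fintype.sum_option]; rfl
  let α : Option (Fin d) → ℕ → ℂ := fun j =>
    j.elim (fun k => b ^ k / (k.factorial : ℂ)) (fun i k => t i k * y i ^ k)
  have hα : tp (n + 1) (fun k => b ^ k / (k.factorial : ℂ)) *
        ∏ i, tp (n + 1) (fun k => t i k * y i ^ k) = ∏ j, tp (n + 1) (α j) := by
    rw [Fintype.prod_option]; rfl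
  rw [hz, hα, prod_tp_coeff, Finset.sum_pow_eq_sum_piAntidiag, Finset.mul_sum, map_sum]
  refine Finset.sum_congr rfl fun κ hκ => ?_
  have hsum : ∑ j, κ j = n := (Finset.mem_piAntidiag.1 hκ).1
  have hm := Nat.multinomial_spec (Finset.univ : Finset (Option (Fin d))) κ
  rw [hsum] at hm
  have hmon : MvPolynomial.C ((n.factorial : ℂ)⁻¹) *
      ((Nat.multinomial Finset.univ κ : MvPolynomial (Fin d) ℂ) * ∏ j, z j ^ κ j)
      = MvPolynomial.monomial (Finsupp.equivFunOnFinite.symm (fun i => κ (some i)))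
        ((n.factorial : ℂ)⁻¹ * ((Nat.multinomial Finset.univ κ : ℂ) *
          (b ^ κ none * ∏ i, y i ^ κ (some i)))) := by
    rw [MvPolynomial.monomial_eq, Fintype.prod_option]
    rw [Finsupp.prod_fintype _ _ (by simp)]
    simp only [z, Option.elim, mul_pow, Finset.prod_mul_distrib, map_mul, map_prod, map_pow,
      map_natCast, Finsupp.equivFunOnFinite_symm_apply_apply]
    ring
  rw [hmon, Phi_monomial]
  simp only [Finsupp.equivFunOnFinite_symm_apply_apply]
  rw [Fintype.prod_option] at hm ⊢
  have hn : (n.factorial : ℂ) ≠ 0 := by exact_mod_cast n.factorial_ne_zero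
  have hk : ((κ none).factorial : ℂ) ≠ 0 := by exact_mod_cast (κ none).factorial_ne_zero
  simp only [α, Option.elim, Finset.prod_mul_distrib]
  have hmC : ((κ none).factorial : ℂ) * (∏ i, ((κ (some i)).factorial : ℂ)) *
      (Nat.multinomial Finset.univ κ : ℂ) = (n.factorial : ℂ) := by
    exact_mod_cast congrArg (Nat.cast : ℕ → ℂ) hm
  field_simp
  rw [← hmC]
  ring

end P8
open Finset
open Filter Topology Asymptotics

section P9
variable {n d : ℕ} {Δ : LMultiFan n d} {uu : Finset (Fin d) → Fin d → (Fin n → ℝ)}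

lemma td_one {n : ℕ} {td : ℂ → ℕ → ℂ} (htd : ToddCoeffs n td) : td 1 0 = 1 := by
  have := htd 1 1 (by omega)
  simpa [Finset.sum_range_succ] using this

lemma td_zero {n : ℕ} {td : ℂ → ℕ → ℂ} (htd : ToddCoeffs n td) {r : ℂ} (hr : r ≠ 1) :
    td r 0 = 0 := by
  have := htd r 0 (by omega)
  simp at this
  rcases this with h | h
  · exact h
  · exact absurd (sub_eq_zero.1 h).symm hr

lemma tp_zero (n : ℕ) (f : ℕ → ℂ) : tp (n + 1) (fun k => f k * (0 : ℂ) ^ k)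
    = Polynomial.C (f 0) := by
  unfold tp
  rw [Finset.sum_eq_single 0]
  · simp
  · intro b _ hb; simp [hb]
  · simp

lemma mem_GDI_iff {I : Finset (Fin d)} {a : Fin d → ℝ} (hS : I ∈ Δ.S) (hI : I.card = n) :
    a ∈ GDI Δ I ↔ a ∈ GD Δ ∧ ∀ j, j ∉ I → a j = 0 := by
  constructor
  · rintro ⟨h1, h2, h3⟩
    exact ⟨⟨h1, I, hS, hI, h2, h3⟩, h2⟩
  · rintro ⟨⟨h1, J, _, _, h4, h5⟩, h2⟩
    refine ⟨h1, h2, fun k => ?_⟩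
    obtain ⟨m, hm⟩ := h5 k
    refine ⟨m, ?_⟩
    rw [← hm, Finset.sum_subset (Finset.subset_univ I), Finset.sum_subset (Finset.subset_univ J)]
    · intro x _ hx; rw [h4 x hx, zero_mul]
    · intro x _ hx; rw [h2 x hx, zero_mul]

lemma GD_finite (huu : Δ.toMF.DualBasis uu) : (GD Δ).Finite := by
  have : (⋃ I ∈ Δ.S.filter (fun I => I.card = n), GDI Δ I).Finite := by
    refine Set.Finite.biUnion (Finset.finite_toSet _) fun I hI => ?_
    obtain ⟨hS, hI⟩ := Finset.mem_filter.1 hI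
    exact GDI_finite huu hS hI
  refine this.subset ?_
  rintro a ⟨h1, I, hS, hI, h2, h3⟩
  simp only [Set.mem_iUnion]
  exact ⟨I, Finset.mem_filter.2 ⟨hS, hI⟩, h1, h2, h3⟩

open scoped Classical in
/-- The coefficient vector of the linear form at the vertex `I`. -/
noncomputable def yv (uu : Finset (Fin d) → Fin d → (Fin n → ℝ)) (ξ : Fin n → ℝ)
    (I : Finset (Fin d)) (i : Fin d) : ℂ :=
  if i ∈ I then ((dotp (uu I i) ξ : ℝ) : ℂ) else 0

lemma prod_tp_yv {td : ℂ → ℕ → ℂ} (htd : ToddCoeffs n td) (ξ : Fin n → ℝ)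
    (I : Finset (Fin d)) (a : Fin d → ℝ) (ha : ∀ j, j ∉ I → a j = 0) :
    ∏ i, tp (n + 1) (fun k => td (e1 (a i)) k * yv uu ξ I i ^ k)
      = ∏ i ∈ I, tp (n + 1) (fun k => td (e1 (a i)) k * ((dotp (uu I i) ξ : ℝ) : ℂ) ^ k) := by
  rw [← Finset.prod_subset (Finset.subset_univ I)]
  · refine Finset.prod_congr rfl fun i hi => ?_
    simp only [yv, if_pos hi]
  · intro i _ hi
    simp only [yv, if_neg hi]
    rw [tp_zero, ha i hi]
    have : e1 0 = 1 := by simpa using e1_int 0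
    rw [this, td_one htd, map_one]

lemma prod_tp_yv_zero {td : ℂ → ℕ → ℂ} (htd : ToddCoeffs n td) (ξ : Fin n → ℝ)
    (I : Finset (Fin d)) (a : Fin d → ℝ) (ha : ¬ ∀ j, j ∉ I → a j = 0)
    (h01 : ∀ i, 0 ≤ a i ∧ a i < 1) :
    ∏ i, tp (n + 1) (fun k => td (e1 (a i)) k * yv uu ξ I i ^ k) = 0 := by
  push Not at ha
  obtain ⟨j, hj, hj0⟩ := ha
  refine Finset.prod_eq_zero (Finset.mem_univ j) ?_
  simp only [yv, if_neg hj]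
  rw [tp_zero, td_zero htd, map_zero]
  intro h
  obtain ⟨m, hm⟩ := (e1_eq_one _).1 h
  have h1 := (h01 j).1
  have h2 := (h01 j).2
  rw [hm] at h1 h2 hj0
  have h1' : 0 ≤ m := by exact_mod_cast h1
  have h2' : m < 1 := by exact_mod_cast h2
  have : m = 0 := by omega
  exact hj0 (by rw [this]; simp)

/-- The volume polynomial. -/
noncomputable def W0 (Δ : LMultiFan n d) (c : Fin d → ℝ)
    (uu : Finset (Fin d) → Fin d → (Fin n → ℝ)) (ξ : Fin n → ℝ) : MvPolynomial (Fin d) ℂ :=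
  ∑ I ∈ Δ.S.filter (fun I => I.card = n), cf Δ uu ξ I •
    (MvPolynomial.C ((n.factorial : ℂ)⁻¹) *
      (MvPolynomial.C ((∑ i ∈ I, c i * dotp (uu I i) ξ : ℝ) : ℂ)
        + ∑ i, MvPolynomial.C (yv uu ξ I i) * MvPolynomial.X i) ^ n)

lemma eval_W0 (hC : Δ.toMF.Complete) (huu : Δ.toMF.DualBasis uu) {ξ : Fin n → ℝ}
    (hξ : Δ.toMF.GenericDual uu ξ) (c h : Fin d → ℝ) :
    MvPolynomial.eval (fun i => ((h i : ℝ) : ℂ)) (W0 Δ c uu ξ)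
      = (((∫ u : Fin n → ℝ, (Δ.toMF.DH (fun i => c i + h i) uu ξ u : ℝ)) : ℝ) : ℂ) := by
  rw [vol_formula hC huu hξ, W0, map_sum]
  refine Finset.sum_congr rfl fun I _ => ?_
  rw [MvPolynomial.smul_eval]
  congr 1
  simp only [map_mul, map_pow, map_add, map_sum, MvPolynomial.eval_C, MvPolynomial.eval_X]
  rw [div_eq_inv_mul]
  congr 2
  have : ∑ i, yv uu ξ I i * (h i : ℂ) = ∑ i ∈ I, ((dotp (uu I i) ξ : ℝ) : ℂ) * (h i : ℂ) := by
    rw [← Finset.sum_subset (Finset.subset_univ I)]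
    · exact Finset.sum_congr rfl fun i hi => by simp only [yv, if_pos hi]
    · intro i _ hi; simp only [yv, if_neg hi, zero_mul]
  rw [this]
  push_cast
  rw [← Finset.sum_add_distrib]
  exact Finset.sum_congr rfl fun i _ => by ring

lemma todd_W0 (hC : Δ.toMF.Complete) (huu : Δ.toMF.DualBasis uu) {ξ : Fin n → ℝ}
    (hξ : Δ.toMF.GenericDual uu ξ) (c : Fin d → ℝ) (hlat : Δ.LatticeVertices c uu)
    (td : ℂ → ℕ → ℂ) (htd : ToddCoeffs n td) :
    ∑ a ∈ (GD_finite huu).toFinset,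
      Phi (fun m => (∏ i, td (e1 (a i)) (m i)) * ∏ i, ((m i).factorial : ℂ)) (W0 Δ c uu ξ)
      = (Δ.sharpP c uu ξ : ℂ) := by
  rw [count_formula hC huu hξ c hlat td htd]
  simp only [W0, map_sum, map_smul, smul_eq_mul]
  rw [Finset.sum_comm]
  refine Finset.sum_congr rfl fun I hI => ?_
  obtain ⟨hS, hI⟩ := Finset.mem_filter.1 hI
  rw [← Finset.mul_sum]
  congr 1
  have hsub : GDF Δ I ⊆ (GD_finite huu).toFinset := by
    intro a ha
    rw [GDF_eq huu hS hI, Set.Finite.mem_toFinset] at ha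
    exact (Set.Finite.mem_toFinset _).2 ((mem_GDI_iff hS hI).1 ha).1
  rw [← Finset.sum_subset hsub]
  · refine Finset.sum_congr rfl fun a ha => ?_
    rw [GDF_eq huu hS hI, Set.Finite.mem_toFinset] at ha
    rw [Phi_pow n (fun i => td (e1 (a i))), prod_tp_yv htd ξ I a ha.2.1]
  · intro a ha hna
    rw [Set.Finite.mem_toFinset] at ha
    rw [GDF_eq huu hS hI, Set.Finite.mem_toFinset] at hna
    rw [Phi_pow n (fun i => td (e1 (a i))), prod_tp_yv_zero htd ξ I a _ ha.1]
    · simp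
    · exact fun h => hna ((mem_GDI_iff hS hI).2 ⟨ha, h⟩)

lemma eq_of_eval_real {W W' : MvPolynomial (Fin d) ℂ}
    (h : ∀ h : Fin d → ℝ, MvPolynomial.eval (fun i => ((h i : ℝ) : ℂ)) W
      = MvPolynomial.eval (fun i => ((h i : ℝ) : ℂ)) W') : W = W' := by
  refine MvPolynomial.funext_set (s := fun _ => Set.range ((↑) : ℝ → ℂ))
    (fun _ => Set.infinite_range_of_injective Complex.ofReal_injective) ?_
  intro x hx
  choose y hy using fun i => hx i (Set.mem_univ i)
  have : x = fun i => ((y i : ℝ) : ℂ) := funext fun i => (hy i).symm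
  rw [this]
  exact h y

end P9

/-- **Theorem 8.7** (Khovanskii–Pukhlikov formula for simple lattice multi-polytopes):
`vol(P_h)` is a polynomial `W` in `h = (h_1,…,h_d)`, and applying the Todd operator
`T(∂/∂h) = ∑_{g∈G_Δ} ∏_i (∂/∂h_i)/(1 − ρ_i(g)e^{−∂/∂h_i})` and evaluating at `h = 0`
yields `♯(P)`.  For a polynomial `W` the evaluation of `∏_i f_i(∂/∂h_i) W` at `h = 0`,
with `f_i = ∑_k a_i(k) x^k`, equals `∑_m (∏_i a_i(m_i) · m_i!) · (coeff of h^m in W)`,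
which is the expression below. -/
theorem stmt19 (n d : ℕ) (Δ : LMultiFan n d) (hC : Δ.toMF.Complete)
    (c : Fin d → ℝ) (uu : Finset (Fin d) → Fin d → (Fin n → ℚ))
    (huu : Δ.toMF.DualBasis (fun I i k => ((uu I i k : ℝ))))
    (ξ : Fin n → ℝ) (hξ : Δ.toMF.GenericDual (fun I i k => ((uu I i k : ℝ))) ξ)
    (hlat : Δ.LatticeVertices c (fun I i k => ((uu I i k : ℝ))))
    (td : ℂ → ℕ → ℂ) (htd : ToddCoeffs n td) :
    (∃ W : MvPolynomial (Fin d) ℂ, ∀ h : Fin d → ℝ,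
        MvPolynomial.eval (fun i => ((h i : ℝ) : ℂ)) W
          = ((∫ u : Fin n → ℝ,
              (Δ.toMF.DH (fun i => c i + h i) (fun I i k => ((uu I i k : ℝ))) ξ u : ℝ)) : ℂ)) ∧
    (∀ W : MvPolynomial (Fin d) ℂ,
      (∀ h : Fin d → ℝ,
        MvPolynomial.eval (fun i => ((h i : ℝ) : ℂ)) W
          = ((∫ u : Fin n → ℝ,
              (Δ.toMF.DH (fun i => c i + h i) (fun I i k => ((uu I i k : ℝ))) ξ u : ℝ)) : ℂ)) →
      (∑ᶠ a : ↥(GD Δ), ∑ m ∈ W.support,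
          (∏ i : Fin d, td (rho i (a : Fin d → ℝ)) (m i)) *
          (∏ i : Fin d, (Nat.factorial (m i) : ℂ)) * MvPolynomial.coeff m W)
        = (Δ.sharpP c (fun I i k => ((uu I i k : ℝ))) ξ : ℂ)) := by
  have hev : ∀ h : Fin d → ℝ,
      MvPolynomial.eval (fun i => ((h i : ℝ) : ℂ)) (W0 Δ c (fun I i k => ((uu I i k : ℝ))) ξ)
          = ((∫ u : Fin n → ℝ,
              (Δ.toMF.DH (fun i => c i + h i) (fun I i k => ((uu I i k : ℝ))) ξ u : ℝ)) : ℂ) := by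
    intro h
    rw [eval_W0 hC huu hξ c h]
    rw [← integral_complex_ofReal]
  refine ⟨⟨_, hev⟩, fun W hW => ?_⟩
  have hWW : W = W0 Δ c (fun I i k => ((uu I i k : ℝ))) ξ :=
    eq_of_eval_real fun h => (hW h).trans (hev h).symm
  rw [← todd_W0 hC huu hξ c hlat td htd, ← hWW]
  simp only [Phi_apply]
  rw [finsum_set_coe_eq_finsum_mem
    (f := fun a : Fin d → ℝ => ∑ m ∈ W.support,
          (∏ i : Fin d, td (rho i a) (m i)) *
          (∏ i : Fin d, (Nat.factorial (m i) : ℂ)) * MvPolynomial.coeff m W)]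
  rw [finsum_mem_eq_finite_toFinset_sum _ (GD_finite huu)]
  rfl
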